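/- arXiv:nlin/0306047 — 2 statements merged into one kernel-verified Lean document; each statement's English description precedes it below -/
import Mathlib

section
/- Necessity part of the scaling theorem for the constant kernel: Let ν₀ be a finite positive measure on (0,∞) and let (ν_t)_{t≥0} be the solution of Smoluchowski's coagulation equation with kernel K=2 and initial data ν₀, and set F(t,x) = ν_t((0,x])/ν_t((0,∞)) for t > 0. Suppose there is a function λ : (0,∞) → (0,∞) with λ(t) → ∞ as t → ∞ and a nontrivial probability distribution function F_* (i.e. F_* is nondecreasing right-continuous with lim_{x→∞} F_*(x) = 1 and F_*(x) < 1 for some x > 0) such that lim_{t→∞} F(t, λ(t)x) = F_*(x) at every point x of continuity of F_*. Then there exist ρ ∈ (0,1] and a function L slowly varying at infinity such that ∫₀^x y ν₀(dy) ~ x^{1−ρ} L(x) as x → ∞. -/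
open MeasureTheory Filter Topology Set Real

noncomputable section

lemma poly_moment (κ : Measure ℝ) (W X : ℝ → ℝ) 
    (hX : Measurable X) (hX0 : ∀ᵐ x ∂κ, 0 ≤ X x)
    (hInt : Integrable (fun x => W x * exp (-X x)) κ) (k : ℕ) :
    Integrable (fun x => W x * exp (-X x) ^ (k+1)) κ := by
  have : (fun x => W x * exp (-X x) ^ (k+1)) =
      fun x => exp (-X x) ^ k * (W x * exp (-X x)) := by
    funext x; ring
  rw [this]
  refine hInt.bdd_mul (c := 1) ?_ ?_
  · exact (by fun_prop : Measurable fun x => exp (-X x) ^ k).aestronglyMeasurable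
  · filter_upwards [hX0] with x hx
    rw [Real.norm_of_nonneg (by positivity)]
    exact pow_le_one₀ (by positivity) (by simpa using hx)

lemma poly_expand (κ : Measure ℝ) (W X : ℝ → ℝ) 
    (hX : Measurable X) (hX0 : ∀ᵐ x ∂κ, 0 ≤ X x)
    (hInt : Integrable (fun x => W x * exp (-X x)) κ) (p : Polynomial ℝ) :
    Integrable (fun x => W x * exp (-X x) * p.eval (exp (-X x))) κ ∧
    ∫ x, W x * exp (-X x) * p.eval (exp (-X x)) ∂κ =
      ∑ k ∈ Finset.range (p.natDegree + 1), p.coeff k * ∫ x, W x * exp (-X x) ^ (k+1) ∂κ := by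
  have h : (fun x => W x * exp (-X x) * p.eval (exp (-X x))) =
      fun x => ∑ k ∈ Finset.range (p.natDegree + 1), p.coeff k * (W x * exp (-X x) ^ (k+1)) := by
    funext x
    rw [Polynomial.eval_eq_sum_range, Finset.mul_sum]
    refine Finset.sum_congr rfl fun k _ => by ring
  have hk : ∀ k ∈ Finset.range (p.natDegree + 1),
      Integrable (fun x => p.coeff k * (W x * exp (-X x) ^ (k+1))) κ :=
    fun k _ => (poly_moment κ W X hX hX0 hInt k).const_mul _
  rw [h]
  refine ⟨integrable_finsetSum _ hk, ?_⟩
  rw [integral_finsetSum _ hk]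
  simp_rw [integral_const_mul]

lemma approx_est (κ : Measure ℝ) (W X : ℝ → ℝ) 
    (hX : Measurable X) (hX0 : ∀ᵐ x ∂κ, 0 ≤ X x ∧ 0 ≤ W x)
    (hInt : Integrable (fun x => W x * exp (-X x)) κ) (p : Polynomial ℝ) (q : ℝ → ℝ)
    (hq : Continuous q) (ε : ℝ) (hp : ∀ y ∈ Icc (0:ℝ) 1, |p.eval y - q y| < ε) :
    |∫ x, W x * exp (-X x) * q (exp (-X x)) ∂κ
      - ∫ x, W x * exp (-X x) * p.eval (exp (-X x)) ∂κ| ≤ ε * ∫ x, W x * exp (-X x) ∂κ := by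
  have hX1 : ∀ᵐ x ∂κ, 0 ≤ X x := hX0.mono fun x h => h.1
  have hpI := (poly_expand κ W X hX hX1 hInt p).1
  have hb : ∀ᵐ x ∂κ, ‖W x * exp (-X x) * q (exp (-X x)) - W x * exp (-X x) * p.eval (exp (-X x))‖
      ≤ ε * (W x * exp (-X x)) := by
    filter_upwards [hX0] with x hx
    have h1 := hp (exp (-X x)) ⟨by positivity, by simpa using hx.1⟩
    rw [← mul_sub, norm_mul, Real.norm_of_nonneg (mul_nonneg hx.2 (by positivity)), Real.norm_eq_abs,
      abs_sub_comm, mul_comm]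
    exact mul_le_mul_of_nonneg_right h1.le (mul_nonneg hx.2 (by positivity))
  have hD : Integrable (fun x => W x * exp (-X x) * q (exp (-X x)) -
      W x * exp (-X x) * p.eval (exp (-X x))) κ := by
    refine Integrable.mono' (hInt.const_mul ε) ?_ hb
    refine AEStronglyMeasurable.sub (hInt.aestronglyMeasurable.mul ?_) hpI.aestronglyMeasurable
    exact (hq.measurable.comp (by fun_prop)).aestronglyMeasurable
  have hqI : Integrable (fun x => W x * exp (-X x) * q (exp (-X x))) κ := by
    have := hD.add hpI
    refine this.congr (Eventually.of_forall fun x => by simp)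
  rw [← integral_sub hqI hpI, ← integral_const_mul, ← Real.norm_eq_abs]
  exact norm_integral_le_of_norm_le (hInt.const_mul ε) hb

lemma tauber_q {l : Filter ℝ} (κ κ' : Measure ℝ) (W X : ℝ → ℝ → ℝ) (W' X' : ℝ → ℝ)
    (hX : ∀ i, Measurable (X i)) (hX0 : ∀ᶠ i in l, ∀ᵐ x ∂κ, 0 ≤ X i x ∧ 0 ≤ W i x)
    (hInt : ∀ᶠ i in l, Integrable (fun x => W i x * exp (-X i x)) κ)
    (hX' : Measurable X') (hX0' : ∀ᵐ x ∂κ', 0 ≤ X' x ∧ 0 ≤ W' x)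
    (hInt' : Integrable (fun x => W' x * exp (-X' x)) κ')
    (hmom : ∀ k : ℕ, Tendsto (fun i => ∫ x, W i x * exp (-X i x) ^ (k+1) ∂κ) l
      (𝓝 (∫ x, W' x * exp (-X' x) ^ (k+1) ∂κ')))
    (q : ℝ → ℝ) (hq : Continuous q) :
    Tendsto (fun i => ∫ x, W i x * exp (-X i x) * q (exp (-X i x)) ∂κ) l
      (𝓝 (∫ x, W' x * exp (-X' x) * q (exp (-X' x)) ∂κ')) := by
  set B := ∫ x, W' x * exp (-X' x) ∂κ' with hB
  have hB0 : 0 ≤ B := integral_nonneg_of_ae (hX0'.mono fun x h => mul_nonneg h.2 (by positivity))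
  have hBt : Tendsto (fun i => ∫ x, W i x * exp (-X i x) ∂κ) l (𝓝 B) := by
    simpa using hmom 0
  rw [Metric.tendsto_nhds]
  intro ε hε
  set δ := ε / (2 * (B + 1) + 1) with hδ
  have hδ0 : 0 < δ := by positivity
  obtain ⟨p, hp⟩ := exists_polynomial_near_of_continuousOn 0 1 q hq.continuousOn δ hδ0
  have hP : Tendsto (fun i => ∫ x, W i x * exp (-X i x) * p.eval (exp (-X i x)) ∂κ) l
      (𝓝 (∫ x, W' x * exp (-X' x) * p.eval (exp (-X' x)) ∂κ')) := by
    rw [(poly_expand κ' W' X' hX' (hX0'.mono fun x h => h.1) hInt' p).2]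
    refine (tendsto_finsetSum _ fun k _ => (hmom k).const_mul (p.coeff k)).congr' ?_
    filter_upwards [hX0, hInt] with i h1 h2
    rw [(poly_expand κ (W i) (X i) (hX i) (h1.mono fun x h => h.1) h2 p).2]
  have e' := approx_est κ' W' X' hX' hX0' hInt' p q hq δ hp
  filter_upwards [hX0, hInt, Metric.tendsto_nhds.1 hP δ hδ0, hBt.eventually_lt_const (lt_add_one B)]
    with i h1 h2 h3 h4
  have e := approx_est κ (W i) (X i) (hX i) h1 h2 p q hq δ hp
  rw [Real.dist_eq] at h3 ⊢
  have h5 : δ * (2 * (B + 1) + 1) = ε := by rw [hδ]; field_simp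
  have h6 : δ * ∫ x, W i x * exp (-X i x) ∂κ < δ * (B+1) := mul_lt_mul_of_pos_left h4 hδ0
  rw [← hB] at e'
  rw [abs_lt] at *
  rw [abs_le] at *
  constructor <;> nlinarith

lemma tauber_T {l : Filter ℝ} (κ κ' : Measure ℝ) (W X : ℝ → ℝ → ℝ) (W' X' : ℝ → ℝ)
    (hX : ∀ i, Measurable (X i)) (hX0 : ∀ᶠ i in l, ∀ᵐ x ∂κ, 0 ≤ X i x ∧ 0 ≤ W i x)
    (hInt : ∀ᶠ i in l, Integrable (fun x => W i x * exp (-X i x)) κ)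
    (hX' : Measurable X') (hX0' : ∀ᵐ x ∂κ', 0 ≤ X' x ∧ 0 ≤ W' x)
    (hInt' : Integrable (fun x => W' x * exp (-X' x)) κ')
    (hmom : ∀ k : ℕ, Tendsto (fun i => ∫ x, W i x * exp (-X i x) ^ (k+1) ∂κ) l
      (𝓝 (∫ x, W' x * exp (-X' x) ^ (k+1) ∂κ')))
    (T : ℝ → ℝ) (hT : Continuous T) (b : ℝ) (hTb : ∀ x, b ≤ x → T x = 0) :
    Tendsto (fun i => ∫ x, W i x * T (X i x) ∂κ) l (𝓝 (∫ x, W' x * T (X' x) ∂κ')) := by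
  have hpos : ∀ y : ℝ, 0 < max y (exp (-b)) := fun y => lt_max_of_lt_right (exp_pos _)
  let q : ℝ → ℝ := fun y => T (-Real.log (max y (exp (-b)))) / max y (exp (-b))
  have hq : Continuous q := by
    refine Continuous.div (hT.comp (Continuous.neg (Continuous.log (by fun_prop) ?_))) (by fun_prop) ?_
    · exact fun y => (hpos y).ne'
    · exact fun y => (hpos y).ne'
  have key : ∀ x, exp (-x) * q (exp (-x)) = T x := by
    intro x
    simp only [q]
    rcases le_total x b with h | h
    · rw [max_eq_left (by simpa using h), Real.log_exp, neg_neg]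
      field_simp
    · rw [max_eq_right (by simpa using h), Real.log_exp, neg_neg, hTb b le_rfl, hTb x h]
      simp
  have := tauber_q κ κ' W X W' X' hX hX0 hInt hX' hX0' hInt' hmom q hq
  simpa only [mul_assoc, key] using this

lemma tauber_step {l : Filter ℝ} (κ κ' : Measure ℝ) (W X : ℝ → ℝ → ℝ) (W' X' : ℝ → ℝ)
    (hX : ∀ i, Measurable (X i)) (hX0 : ∀ᶠ i in l, ∀ᵐ x ∂κ, 0 ≤ X i x ∧ 0 ≤ W i x)
    (hInt : ∀ᶠ i in l, Integrable (fun x => W i x * exp (-X i x)) κ)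
    (hWi : ∀ᶠ i in l, ∀ c, IntegrableOn (W i) {x | X i x ≤ c} κ)
    (hX' : Measurable X') (hX0' : ∀ᵐ x ∂κ', 0 ≤ X' x ∧ 0 ≤ W' x)
    (hInt' : Integrable (fun x => W' x * exp (-X' x)) κ')
    (hWi' : ∀ c, IntegrableOn W' {x | X' x ≤ c} κ')
    (hmom : ∀ k : ℕ, Tendsto (fun i => ∫ x, W i x * exp (-X i x) ^ (k+1) ∂κ) l
      (𝓝 (∫ x, W' x * exp (-X' x) ^ (k+1) ∂κ')))
    (H : ℝ → ℝ) (hH : ∀ c, 0 < c → ∫ x in {x | X' x ≤ c}, W' x ∂κ' = H c)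
    (c : ℝ) (hc : 0 < c) (hHc : ContinuousAt H c) :
    Tendsto (fun i => ∫ x in {x | X i x ≤ c}, W i x ∂κ) l (𝓝 (H c)) := by
  let T : ℝ → ℝ → ℝ → ℝ := fun a b x => max 0 (min 1 ((b - x) / (b - a)))
  have hTc : ∀ a b, Continuous (T a b) := fun a b => by fun_prop
  have hT0 : ∀ a b x, 0 ≤ T a b x := fun a b x => le_max_left _ _
  have hT1 : ∀ a b x, T a b x ≤ 1 := fun a b x => max_le zero_le_one (min_le_left _ _)
  have hTb : ∀ a b, a < b → ∀ x, b ≤ x → T a b x = 0 := by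
    intro a b hab x hx
    refine max_eq_left ((min_le_right _ _).trans ?_)
    exact div_nonpos_of_nonpos_of_nonneg (by linarith) (by linarith)
  have hTa : ∀ a b, a < b → ∀ x, x ≤ a → T a b x = 1 := by
    intro a b hab x hx
    have : 1 ≤ (b - x) / (b - a) := by rw [le_div_iff₀ (by linarith)]; linarith
    simp only [T]; rw [min_eq_left this]; simp
  have sand : ∀ (κ : Measure ℝ) (W X : ℝ → ℝ), Measurable X → (∀ᵐ x ∂κ, 0 ≤ X x ∧ 0 ≤ W x) →
      (∀ c, IntegrableOn W {x | X x ≤ c} κ) → ∀ a b, a < b →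
      ∫ x in {x | X x ≤ a}, W x ∂κ ≤ ∫ x, W x * T a b (X x) ∂κ ∧
      ∫ x, W x * T a b (X x) ∂κ ≤ ∫ x in {x | X x ≤ b}, W x ∂κ := by
    intro κ W X hX h0 hW a b hab
    have hm : ∀ c, MeasurableSet {x | X x ≤ c} := fun c => measurableSet_le hX measurable_const
    have hI : ∀ c, Integrable (indicator {x | X x ≤ c} W) κ := fun c =>
      (integrable_indicator_iff (hm c)).2 (hW c)
    have heq : (fun x => W x * T a b (X x)) =
        fun x => T a b (X x) * indicator {x | X x ≤ b} W x := by
      funext x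
      by_cases hx : X x ≤ b
      · rw [indicator_of_mem (by exact hx), mul_comm]
      · rw [indicator_of_notMem (by exact hx), hTb a b hab _ (not_le.1 hx).le]; simp
    have hTI : Integrable (fun x => W x * T a b (X x)) κ := by
      rw [heq]
      refine (hI b).bdd_mul (c := 1) ((hTc a b).measurable.comp hX).aestronglyMeasurable ?_
      exact Eventually.of_forall fun x => by
        rw [Real.norm_of_nonneg (hT0 _ _ _)]; exact hT1 _ _ _
    rw [← integral_indicator (hm a), ← integral_indicator (hm b)]
    constructor
    · refine integral_mono_ae (hI a) hTI ?_
      filter_upwards [h0] with x hx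
      by_cases h : X x ≤ a
      · rw [indicator_of_mem (by exact h), hTa a b hab _ h, mul_one]
      · rw [indicator_of_notMem (by exact h)]; exact mul_nonneg hx.2 (hT0 _ _ _)
    · refine integral_mono_ae hTI (hI b) ?_
      filter_upwards [h0] with x hx
      by_cases h : X x ≤ b
      · rw [indicator_of_mem (by exact h)]; exact mul_le_of_le_one_right hx.2 (hT1 _ _ _)
      · rw [indicator_of_notMem (by exact h), hTb a b hab _ (not_le.1 h).le, mul_zero]
  have hTt := fun a b (hab : a < b) => tauber_T κ κ' W X W' X' hX hX0 hInt hX' hX0' hInt' hmom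
    (T a b) (hTc a b) b (hTb a b hab)
  rw [tendsto_order]
  constructor
  · intro r hr
    have h1 : ∀ᶠ a in 𝓝[<] c, r < H a ∧ 0 < a ∧ a < c :=
      ((hHc.eventually_const_lt hr).filter_mono nhdsWithin_le_nhds).and
        (((lt_mem_nhds hc).filter_mono nhdsWithin_le_nhds).and self_mem_nhdsWithin)
    obtain ⟨a, ha, ha0, hac⟩ := h1.exists
    have h2 := (sand κ' W' X' hX' hX0' hWi' a c hac).1
    rw [hH a ha0] at h2
    filter_upwards [(hTt a c hac).eventually_const_lt (ha.trans_le h2), hX0, hWi] with i h3 h4 h5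
    exact h3.trans_le (sand κ (W i) (X i) (hX i) h4 h5 a c hac).2
  · intro r hr
    have h1 : ∀ᶠ a in 𝓝[>] c, H a < r ∧ c < a :=
      ((hHc.eventually_lt_const hr).filter_mono nhdsWithin_le_nhds).and self_mem_nhdsWithin
    obtain ⟨a, ha, hac⟩ := h1.exists
    have h2 := (sand κ' W' X' hX' hX0' hWi' c a hac).2
    rw [hH a (hc.trans hac)] at h2
    filter_upwards [(hTt c a hac).eventually_lt_const (h2.trans_lt ha), hX0, hWi] with i h3 h4 h5
    exact (sand κ (W i) (X i) (hX i) h4 h5 c a hac).1.trans_lt h3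

lemma limit_meas (α : ℝ) (hα : 0 ≤ α) : ∃ (κ : Measure ℝ) (W : ℝ → ℝ) (C : ℝ), 0 < C ∧
    (∀ᵐ x ∂κ, 0 ≤ x ∧ 0 ≤ W x) ∧ Integrable (fun x => W x * exp (-x)) κ ∧
    (∀ c, IntegrableOn W {x | x ≤ c} κ) ∧
    (∀ k : ℕ, ∫ x, W x * exp (-x) ^ (k+1) ∂κ = ((k:ℝ)+1) ^ (-α)) ∧
    ∀ c, 0 < c → ∫ x in {x | x ≤ c}, W x ∂κ = C * c ^ α := by
  rcases hα.eq_or_lt with rfl | hα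
  · refine ⟨Measure.dirac 0, fun _ => 1, 1, one_pos, ?_, ?_, ?_, ?_, ?_⟩
    · rw [ae_dirac_eq]; simp
    · refine (integrable_dirac (by simp))
    · exact fun c => (integrable_const _).integrableOn
    · intro k; simp
    · intro c hc
      have : MeasurableSet {x : ℝ | x ≤ c} := measurableSet_Iic
      rw [setIntegral_const]
      simp [Measure.real, Measure.dirac_apply' _ this, hc.le]
  · have hG := Real.Gamma_pos_of_pos hα
    have hm : ∀ c : ℝ, {x : ℝ | x ≤ c} = Iic c := fun c => rfl
    refine ⟨volume.restrict (Ioi 0), fun x => x ^ (α - 1) / Real.Gamma α,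
      1 / (α * Real.Gamma α), by positivity, ?_, ?_, ?_, ?_, ?_⟩
    · filter_upwards [ae_restrict_mem measurableSet_Ioi] with x hx
      have : (0:ℝ) < x := hx
      exact ⟨this.le, by positivity⟩
    · have := integrableOn_rpow_mul_exp_neg_mul_rpow (s := α - 1) (p := 1) (b := 1) (by linarith)
        one_pos one_pos
      refine (this.div_const (Real.Gamma α)).congr (Eventually.of_forall fun x => ?_)
      simp; ring
    · intro c
      rw [hm, IntegrableOn, Measure.restrict_restrict measurableSet_Iic, inter_comm,
        Ioi_inter_Iic]
      rcases le_total c 0 with h | h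
      · rw [Ioc_eq_empty (by simpa using h)]; simp
      · refine Integrable.div_const ?_ _
        have := intervalIntegral.intervalIntegrable_rpow' (a := 0) (b := c) (r := α - 1) (by linarith)
        exact (intervalIntegrable_iff_integrableOn_Ioc_of_le h).1 this
    · intro k
      have := Real.integral_rpow_mul_exp_neg_mul_Ioi hα (r := (k:ℝ)+1) (by positivity)
      have e : ∀ x : ℝ, x ^ (α - 1) / Real.Gamma α * exp (-x) ^ (k+1) =
          (x ^ (α - 1) * exp (-(((k:ℝ)+1) * x))) / Real.Gamma α := by
        intro x
        rw [← Real.exp_nat_mul]; push_cast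
        rw [show ((k:ℝ)+1) * -x = -(((k:ℝ)+1) * x) by ring]; ring
      simp_rw [e]
      rw [integral_div, this, one_div, Real.inv_rpow (by positivity), Real.rpow_neg (by positivity)]
      field_simp
    · intro c hc
      rw [hm, Measure.restrict_restrict measurableSet_Iic, inter_comm, Ioi_inter_Iic, integral_div,
        ← intervalIntegral.integral_of_le hc.le, integral_rpow (Or.inl (by linarith))]
      simp [hα.ne']
      field_simp

lemma rv_of_conv (φ h lam : ℝ → ℝ) (hpos : ∀ s, 0 < s → 0 < φ s)
    (hmono : ∀ s s', 0 < s → s ≤ s' → φ s ≤ φ s')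
    (hsub : ∀ c s, 1 ≤ c → 0 < s → φ (c * s) ≤ c * φ s)
    (hzero : Tendsto φ (𝓝[>] 0) (𝓝 0))
    (hlam : ∀ t, 0 < t → 0 < lam t)
    (hh : ∀ s, 0 < s → 0 < h s) (hst : ∀ s s', 0 < s → s < s' → h s < h s')
    (hconv : ∀ s, 0 < s → Tendsto (fun t => t * φ (s / lam t)) atTop (𝓝 (h s))) :
    ∃ ρ : ℝ, 0 < ρ ∧ ρ ≤ 1 ∧ ∀ s, 0 < s →
      Tendsto (fun u => φ (s * u) / φ u) (𝓝[>] 0) (𝓝 (s ^ ρ)) := by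
  have h1 := hh 1 one_pos
  have hhsub : ∀ c s, 1 ≤ c → 0 < s → h (c * s) ≤ c * h s := by
    intro c s hc hs
    refine le_of_tendsto_of_tendsto (hconv (c * s) (by positivity)) ((hconv s hs).const_mul c) ?_
    filter_upwards [eventually_gt_atTop 0] with t ht
    have := hsub c (s / lam t) hc (div_pos hs (hlam t ht))
    rw [mul_div_assoc]
    nlinarith
  have hφ0 : Tendsto φ (𝓝[>] 0) (𝓝[>] 0) :=
    tendsto_nhdsWithin_iff.2 ⟨hzero, by
      filter_upwards [self_mem_nhdsWithin] with u hu using hpos u hu⟩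
  have hτ : Tendsto (fun u => h 1 / φ u) (𝓝[>] 0) atTop := by
    simp_rw [div_eq_mul_inv]
    exact (tendsto_inv_nhdsGT_zero.comp hφ0).const_mul_atTop h1
  have hloc : ∀ c, 1 < c → ∀ᶠ u in 𝓝[>] (0:ℝ), 
      c⁻¹ / lam (h 1 / φ u) < u ∧ u < c / lam (h 1 / φ u) := by
    intro c hc
    have hc0 : 0 < c := by linarith
    have hci : c⁻¹ < 1 := inv_lt_one_of_one_lt₀ hc
    have a1 := (hconv c⁻¹ (by positivity)).eventually_lt_const (hst _ _ (by positivity) hci)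
    have a2 := (hconv c hc0).eventually_const_lt (hst _ _ one_pos hc)
    filter_upwards [hτ.eventually a1, hτ.eventually a2, self_mem_nhdsWithin] with u b1 b2 hu
    have hu : 0 < u := hu
    have hp := hpos u hu
    have ht : 0 < h 1 / φ u := by positivity
    have e : h 1 / φ u * φ u = h 1 := by field_simp
    have hl := hlam _ ht
    constructor
    · by_contra hcon
      have := hmono u _ hu (not_lt.1 hcon)
      nlinarith
    · by_contra hcon
      have := hmono _ u (by positivity) (not_lt.1 hcon)
      nlinarith
  have key : ∀ s, 0 < s → Tendsto (fun u => h 1 / φ u * φ (s * u)) (𝓝[>] 0) (𝓝 (h s)) := by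
    intro s hs
    have hhs := hh s hs
    rw [tendsto_order]
    constructor
    · intro r hr
      have : ∀ᶠ c in 𝓝[>] (1:ℝ), c * r < h s ∧ 1 < c := by
        have hc : Tendsto (fun c : ℝ => c * r) (𝓝[>] 1) (𝓝 r) := by
          have : Continuous fun c : ℝ => c * r := by fun_prop
          simpa using (this.tendsto 1).mono_left nhdsWithin_le_nhds
        exact (hc.eventually_lt_const hr).and self_mem_nhdsWithin
      obtain ⟨c, hcr, hc⟩ := this.exists
      have hc0 : 0 < c := by linarith
      have h2 : r < h (c⁻¹ * s) := by
        have := hhsub c (c⁻¹ * s) hc.le (by positivity)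
        rw [← mul_assoc, mul_inv_cancel₀ hc0.ne', one_mul] at this
        exact lt_of_mul_lt_mul_left (hcr.trans_le this) hc0.le
      filter_upwards [hτ.eventually ((hconv (c⁻¹ * s) (by positivity)).eventually_const_lt h2),
        hloc c hc, self_mem_nhdsWithin] with u b1 b2 hu
      have hu : 0 < u := hu
      have hp := hpos u hu
      have ht : 0 < h 1 / φ u := by positivity
      have hl := hlam _ ht
      refine b1.trans_le (mul_le_mul_of_nonneg_left (hmono _ _ (by positivity) ?_) ht.le)
      rw [mul_comm c⁻¹ s, mul_div_assoc]
      exact mul_le_mul_of_nonneg_left b2.1.le hs.le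
    · intro r hr
      have : ∀ᶠ c in 𝓝[>] (1:ℝ), c * h s < r ∧ 1 < c := by
        have hc : Tendsto (fun c : ℝ => c * h s) (𝓝[>] 1) (𝓝 (h s)) := by
          have : Continuous fun c : ℝ => c * h s := by fun_prop
          simpa using (this.tendsto 1).mono_left nhdsWithin_le_nhds
        exact (hc.eventually_lt_const hr).and self_mem_nhdsWithin
      obtain ⟨c, hcr, hc⟩ := this.exists
      have hc0 : 0 < c := by linarith
      have h2 : h (c * s) < r := (hhsub c s hc.le hs).trans_lt hcr
      filter_upwards [hτ.eventually ((hconv (c * s) (by positivity)).eventually_lt_const h2),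
        hloc c hc, self_mem_nhdsWithin] with u b1 b2 hu
      have hu : 0 < u := hu
      have hp := hpos u hu
      have ht : 0 < h 1 / φ u := by positivity
      have hl := hlam _ ht
      refine (mul_le_mul_of_nonneg_left (hmono _ _ (by positivity) ?_) ht.le).trans_lt b1
      rw [mul_comm c s, mul_div_assoc]
      exact mul_le_mul_of_nonneg_left b2.2.le hs.le
  let ψ : ℝ → ℝ := fun s => h s / h 1
  have hψ : ∀ s, 0 < s → Tendsto (fun u => φ (s * u) / φ u) (𝓝[>] 0) (𝓝 (ψ s)) := by
    intro s hs
    refine ((key s hs).div_const (h 1)).congr fun u => ?_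
    field_simp
  have hψ0 : ∀ s, 0 < s → 0 < ψ s := fun s hs => div_pos (hh s hs) h1
  have hψmul : ∀ s s', 0 < s → 0 < s' → ψ (s * s') = ψ s * ψ s' := by
    intro s s' hs hs'
    have hscale : Tendsto (fun u => s' * u) (𝓝[>] (0:ℝ)) (𝓝[>] 0) := by
      refine tendsto_nhdsWithin_iff.2 ⟨?_, ?_⟩
      · have : Continuous fun u : ℝ => s' * u := by fun_prop
        simpa using (this.tendsto 0).mono_left nhdsWithin_le_nhds
      · filter_upwards [self_mem_nhdsWithin] with u hu
        exact mul_pos hs' hu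
    refine tendsto_nhds_unique (hψ (s * s') (by positivity)) 
      ((((hψ s hs).comp hscale).mul (hψ s' hs')).congr' ?_)
    filter_upwards [self_mem_nhdsWithin] with u hu
    have hu : 0 < u := hu
    have := hpos (s' * u) (by positivity)
    simp only [Function.comp]
    rw [mul_assoc]
    field_simp
  have hψ1 : ψ 1 = 1 := div_self h1.ne'
  have hψle : ∀ s, 1 ≤ s → ψ s ≤ s := by
    intro s hs
    have := hhsub s 1 hs one_pos
    rw [mul_one] at this
    exact (div_le_iff₀ h1).2 this
  have hψge : ∀ s, 1 ≤ s → 1 ≤ ψ s := by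
    intro s hs
    rcases hs.eq_or_lt with rfl | hs
    · exact hψ1.ge
    · exact ((one_lt_div h1).2 (hst 1 s one_pos hs)).le
  let A : ℝ →+ ℝ := AddMonoidHom.mk' (fun x => Real.log (ψ (exp x))) (by
    intro a b
    rw [Real.exp_add, hψmul _ _ (exp_pos _) (exp_pos _), Real.log_mul (hψ0 _ (exp_pos _)).ne'
      (hψ0 _ (exp_pos _)).ne'])
  have hA : ∀ x, A x = Real.log (ψ (exp x)) := fun x => rfl
  have hAb0 : ∀ x, 0 ≤ x → |A x| ≤ |x| := by
    intro x hx
    have e1 : 1 ≤ exp x := Real.one_le_exp hx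
    rw [hA, abs_of_nonneg (Real.log_nonneg (hψge _ e1)), abs_of_nonneg hx]
    calc Real.log (ψ (exp x)) ≤ Real.log (exp x) :=
          Real.log_le_log (hψ0 _ (exp_pos _)) (hψle _ e1)
      _ = x := Real.log_exp x
  have hAb : ∀ x, ‖A x‖ ≤ 1 * ‖x‖ := by
    intro x
    rw [one_mul, Real.norm_eq_abs, Real.norm_eq_abs]
    rcases le_total 0 x with hx | hx
    · exact hAb0 x hx
    · have := hAb0 (-x) (by linarith)
      rwa [map_neg, abs_neg, abs_neg] at this
  have hAc : Continuous A := AddMonoidHomClass.continuous_of_bound A 1 hAb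
  have hAlin : ∀ x, A x = x * A 1 := by
    intro x
    have := map_real_smul A hAc x 1
    simpa using this
  refine ⟨A 1, ?_, ?_, ?_⟩
  · rw [hA]
    refine Real.log_pos ((one_lt_div h1).2 (hst 1 _ one_pos ?_))
    exact Real.one_lt_exp_iff.2 one_pos
  · have := hAb 1
    rw [Real.norm_eq_abs] at this
    simpa using (le_abs_self _).trans this
  · intro s hs
    have e : ψ s = s ^ (A 1) := by
      have := hAlin (Real.log s)
      rw [hA, Real.exp_log hs] at this
      rw [Real.rpow_def_of_pos hs, ← this, Real.exp_log (hψ0 s hs)]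
    rw [← e]
    exact hψ s hs

lemma integrable_one_sub_exp (μ : Measure ℝ) [IsFiniteMeasure μ] (h0 : ∀ᵐ x ∂μ, 0 < x)
    (s : ℝ) (hs : 0 ≤ s) : Integrable (fun x => 1 - exp (-(s * x))) μ := by
  refine Integrable.of_bound (C := 1) (by fun_prop) ?_
  filter_upwards [h0] with x hx
  have : exp (-(s * x)) ≤ 1 := by
    rw [Real.exp_le_one_iff]; nlinarith [mul_nonneg hs hx.le]
  rw [Real.norm_of_nonneg (by linarith)]
  linarith [exp_pos (-(s * x))]

lemma integrable_x_exp (μ : Measure ℝ) [IsFiniteMeasure μ] (h0 : ∀ᵐ x ∂μ, 0 < x)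
    (s : ℝ) (hs : 0 < s) : Integrable (fun x => x * exp (-(s * x))) μ := by
  refine Integrable.of_bound (C := 1 / s) (by fun_prop) ?_
  filter_upwards [h0] with x hx
  rw [Real.norm_of_nonneg (by positivity), Real.exp_neg, ← div_eq_mul_inv, div_le_div_iff₀
    (by positivity) hs]
  linarith [Real.add_one_le_exp (s * x)]

lemma dens_ineq (μ : Measure ℝ) [IsFiniteMeasure μ] (h0 : ∀ᵐ x ∂μ, 0 < x)
    (a b : ℝ) (ha : 0 < a) (hab : a < b) :
    (b - a) * ∫ x, x * exp (-(b * x)) ∂μ ≤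
      (∫ x, (1 - exp (-(b * x))) ∂μ) - ∫ x, (1 - exp (-(a * x))) ∂μ ∧
    (∫ x, (1 - exp (-(b * x))) ∂μ) - ∫ x, (1 - exp (-(a * x))) ∂μ ≤
      (b - a) * ∫ x, x * exp (-(a * x)) ∂μ := by
  have hb : 0 < b := ha.trans hab
  have i1 := integrable_one_sub_exp μ h0 a ha.le
  have i2 := integrable_one_sub_exp μ h0 b hb.le
  rw [← integral_sub i2 i1, ← integral_const_mul, ← integral_const_mul]
  constructor
  · refine integral_mono ((integrable_x_exp μ h0 b hb).const_mul _) (i2.sub i1) fun x => ?_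
    have e : exp (-(a * x)) = exp (-(b * x)) * exp ((b - a) * x) := by
      rw [← Real.exp_add]; ring_nf
    have := mul_le_mul_of_nonneg_left (Real.add_one_le_exp ((b - a) * x)) (exp_pos (-(b * x))).le
    simp only
    nlinarith
  · refine integral_mono (i2.sub i1) ((integrable_x_exp μ h0 a ha).const_mul _) fun x => ?_
    have e : exp (-(b * x)) = exp (-(a * x)) * exp (-((b - a) * x)) := by
      rw [← Real.exp_add]; ring_nf
    have := mul_le_mul_of_nonneg_left (Real.add_one_le_exp (-((b - a) * x))) (exp_pos (-(a * x))).le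
    simp only
    nlinarith

lemma density_lim (μ : Measure ℝ) [IsFiniteMeasure μ] (h0 : ∀ᵐ x ∂μ, 0 < x)
    (φ : ℝ → ℝ) (hφ : ∀ s, φ s = ∫ x, (1 - exp (-(s * x))) ∂μ)
    (hpos : ∀ s, 0 < s → 0 < φ s) (ρ : ℝ)
    (hrv : ∀ s, 0 < s → Tendsto (fun u => φ (s * u) / φ u) (𝓝[>] 0) (𝓝 (s ^ ρ))) :
    Tendsto (fun u => u * (∫ x, x * exp (-(u * x)) ∂μ) / φ u) (𝓝[>] 0) (𝓝 ρ) := by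
  have hd : HasDerivAt (fun c : ℝ => c ^ ρ) ρ 1 := by
    simpa using Real.hasDerivAt_rpow_const (x := 1) (p := ρ) (Or.inl one_ne_zero)
  have hsl := hasDerivAt_iff_tendsto_slope.1 hd
  have hslope : ∀ c : ℝ, slope (fun c : ℝ => c ^ ρ) 1 c = (c ^ ρ - 1) / (c - 1) := by
    intro c; rw [slope_def_field]; simp
  rw [tendsto_order]
  constructor
  · intro r hr
    have h1 : ∀ᶠ c in 𝓝[>] (1:ℝ), r < slope (fun c : ℝ => c ^ ρ) 1 c ∧ 1 < c :=
      ((hsl.mono_left (nhdsWithin_mono _ fun x (hx : 1 < x) => ne_of_gt hx)).eventually_const_lt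
        hr).and self_mem_nhdsWithin
    obtain ⟨c, hc, hc1⟩ := h1.exists
    rw [hslope] at hc
    have h2 := (((hrv c (by linarith)).sub_const 1).div_const (c - 1)).eventually_const_lt hc
    filter_upwards [h2, self_mem_nhdsWithin] with u b hu
    have hu : 0 < u := hu
    have hp := hpos u hu
    have := (dens_ineq μ h0 u (c * u) hu (by nlinarith)).2
    rw [← hφ, ← hφ] at this
    refine b.trans_le ?_
    have hc2 : 0 < c - 1 := by linarith
    have e : (φ (c * u) / φ u - 1) / (c - 1) = ((φ (c * u) - φ u) / (c - 1)) / φ u := by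
      field_simp
    rw [e]
    refine div_le_div_of_nonneg_right ?_ hp.le
    rw [div_le_iff₀ hc2]
    linarith
  · intro r hr
    have h1 : ∀ᶠ c in 𝓝[<] (1:ℝ), slope (fun c : ℝ => c ^ ρ) 1 c < r ∧ 0 < c ∧ c < 1 :=
      ((hsl.mono_left (nhdsWithin_mono _ fun x (hx : x < 1) => ne_of_lt hx)).eventually_lt_const
        hr).and (((lt_mem_nhds one_pos).filter_mono nhdsWithin_le_nhds).and self_mem_nhdsWithin)
    obtain ⟨c, hc, hc0, hc1⟩ := h1.exists
    rw [hslope] at hc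
    have h2 := (((hrv c hc0).sub_const 1).div_const (c - 1)).eventually_lt_const hc
    filter_upwards [h2, self_mem_nhdsWithin] with u b hu
    have hu : 0 < u := hu
    have hp := hpos u hu
    have := (dens_ineq μ h0 (c * u) u (by positivity) (by nlinarith)).1
    rw [← hφ, ← hφ] at this
    refine lt_of_le_of_lt ?_ b
    have hc2 : 0 < 1 - c := by linarith
    have hc3 : c - 1 ≠ 0 := by linarith
    have e : (φ (c * u) / φ u - 1) / (c - 1) = ((φ u - φ (c * u)) / (1 - c)) / φ u := by
      rw [div_div, div_eq_div_iff (by positivity) (by positivity), div_sub_one hp.ne']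
      field_simp
      ring
    rw [e]
    refine div_le_div_of_nonneg_right ?_ hp.le
    rw [le_div_iff₀ hc2]
    linarith

lemma M_lim (μ : Measure ℝ) [IsFiniteMeasure μ] (h0 : ∀ᵐ x ∂μ, 0 < x)
    (φ : ℝ → ℝ) (hφ : ∀ s, φ s = ∫ x, (1 - exp (-(s * x))) ∂μ)
    (hpos : ∀ s, 0 < s → 0 < φ s) (ρ : ℝ) (hρ0 : 0 < ρ) (hρ1 : ρ ≤ 1)
    (hrv : ∀ s, 0 < s → Tendsto (fun u => φ (s * u) / φ u) (𝓝[>] 0) (𝓝 (s ^ ρ))) :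
    ∃ C, 0 < C ∧ ∀ c, 0 < c → Tendsto (fun u => u / φ u / ρ * ∫ y in Ioc 0 (c / u), y ∂μ) (𝓝[>] 0)
      (𝓝 (C * c ^ (1 - ρ))) := by
  have hD := density_lim μ h0 φ hφ hpos ρ hrv
  obtain ⟨κ, W', C, hC, k1, k2, k3, k4, k5⟩ := limit_meas (1 - ρ) (by linarith)
  refine ⟨C, hC, fun c hc => ?_⟩
  have hmom : ∀ k : ℕ, Tendsto (fun u => ∫ x, (x * (u / φ u / ρ)) * exp (-(u * x)) ^ (k+1) ∂μ)
      (𝓝[>] 0) (𝓝 (∫ x, W' x * exp (-x) ^ (k+1) ∂κ)) := by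
    intro k
    rw [k4]
    have hk : (0:ℝ) < (k:ℝ) + 1 := by positivity
    have hscale : Tendsto (fun u => ((k:ℝ)+1) * u) (𝓝[>] (0:ℝ)) (𝓝[>] 0) := by
      refine tendsto_nhdsWithin_iff.2 ⟨?_, ?_⟩
      · have : Continuous fun u : ℝ => ((k:ℝ)+1) * u := by fun_prop
        simpa using (this.tendsto 0).mono_left nhdsWithin_le_nhds
      · filter_upwards [self_mem_nhdsWithin] with u hu
        exact mul_pos hk hu
    have h1 := (((hD.comp hscale).mul (hrv _ hk)).div_const ρ).div_const ((k:ℝ)+1)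
    have e : ρ * ((k:ℝ)+1) ^ ρ / ρ / ((k:ℝ)+1) = ((k:ℝ)+1) ^ (-(1 - ρ)) := by
      rw [show -(1 - ρ) = ρ - 1 by ring, Real.rpow_sub_one hk.ne']
      field_simp
    rw [e] at h1
    refine h1.congr' ?_
    filter_upwards [self_mem_nhdsWithin] with u hu
    have hu : 0 < u := hu
    have hp := hpos u hu
    have hp' := hpos (((k:ℝ)+1) * u) (by positivity)
    have e2 : ∀ x, (x * (u / φ u / ρ)) * exp (-(u * x)) ^ (k+1) =
        (u / φ u / ρ) * (x * exp (-(((k:ℝ)+1) * u * x))) := by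
      intro x
      rw [← Real.exp_nat_mul]; push_cast
      rw [show ((k:ℝ)+1) * -(u * x) = -(((k:ℝ)+1) * u * x) by ring]; ring
    simp_rw [e2]
    rw [integral_const_mul]
    simp only [Function.comp]
    field_simp
  have hset : ∀ u, 0 < u → ∀ c, {x : ℝ | u * x ≤ c} = Iic (c / u) := by
    intro u hu c; ext x; simp [le_div_iff₀ hu, mul_comm]
  have hres : ∀ d, (μ.restrict (Iic d)) = μ.restrict (Ioc 0 d) := by
    intro d
    refine Measure.restrict_congr_set ?_
    filter_upwards [h0] with x hx
    apply propext
    exact ⟨fun h => ⟨hx, h⟩, fun h => h.2⟩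
  have := tauber_step (l := 𝓝[>] 0) μ κ (fun u x => x * (u / φ u / ρ)) (fun u x => u * x) W'
    (fun x => x) (fun u => by fun_prop) ?_ ?_ ?_ measurable_id k1 k2 k3 hmom
    (fun c => C * c ^ (1 - ρ)) k5 c hc ?_
  · refine this.congr' ?_
    filter_upwards [self_mem_nhdsWithin] with u hu
    have hu : 0 < u := hu
    rw [hset u hu, hres, integral_mul_const, mul_comm]
  · filter_upwards [self_mem_nhdsWithin] with u hu
    have hu : 0 < u := hu
    have hp := hpos u hu
    filter_upwards [h0] with x hx
    exact ⟨by positivity, by positivity⟩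
  · filter_upwards [self_mem_nhdsWithin] with u hu
    have hu : 0 < u := hu
    refine ((integrable_x_exp μ h0 u hu).const_mul (u / φ u / ρ)).congr
      (Eventually.of_forall fun x => by simp only; ring)
  · filter_upwards [self_mem_nhdsWithin] with u hu
    have hu : 0 < u := hu
    intro c
    rw [hset u hu, IntegrableOn, hres]
    refine Integrable.mul_const ?_ _
    refine Integrable.of_bound (C := c / u) (by fun_prop) ?_
    filter_upwards [ae_restrict_mem measurableSet_Ioc] with x hx
    rw [Real.norm_of_nonneg hx.1.le]; exact hx.2
  · exact (Real.continuousAt_rpow_const _ _ (Or.inl hc.ne')).const_mul C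

lemma final_step (μ : Measure ℝ) [IsFiniteMeasure μ] (h0 : ∀ᵐ x ∂μ, 0 < x)
    (φ : ℝ → ℝ) (hφ : ∀ s, φ s = ∫ x, (1 - exp (-(s * x))) ∂μ)
    (hpos : ∀ s, 0 < s → 0 < φ s) (ρ : ℝ) (hρ0 : 0 < ρ) (hρ1 : ρ ≤ 1)
    (hrv : ∀ s, 0 < s → Tendsto (fun u => φ (s * u) / φ u) (𝓝[>] 0) (𝓝 (s ^ ρ))) :
    ∃ L : ℝ → ℝ,
      (∀ x : ℝ, 0 < x → 0 < L x) ∧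
      (∀ c : ℝ, 0 < c → Tendsto (fun x => L (c * x) / L x) atTop (𝓝 1)) ∧
      Tendsto (fun x => (∫ y in Set.Ioc (0:ℝ) x, y ∂μ) / (x ^ (1 - ρ) * L x))
        atTop (𝓝 1) := by
  obtain ⟨C, hC, hlim⟩ := M_lim μ h0 φ hφ hpos ρ hρ0 hρ1 hrv
  set M : ℝ → ℝ := fun x => ∫ y in Ioc 0 x, y ∂μ with hM
  have hlim' : ∀ c, 0 < c → Tendsto (fun x => x⁻¹ / φ x⁻¹ / ρ * M (c * x)) atTop
      (𝓝 (C * c ^ (1 - ρ))) := by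
    intro c hc
    refine ((hlim c hc).comp tendsto_inv_atTop_nhdsGT_zero).congr fun x => ?_
    simp [hM]
  have hMpos : ∀ᶠ x in atTop, 0 < M x := by
    have h1 := hlim' 1 one_pos
    have h2 : 0 < C * (1:ℝ) ^ (1 - ρ) := by simpa using hC
    filter_upwards [h1.eventually_const_lt h2, eventually_gt_atTop 0] with x hx hx0
    rw [one_mul] at hx
    have := hpos x⁻¹ (by positivity)
    exact pos_of_mul_pos_right hx (by positivity)
  have hratio : ∀ c, 0 < c → Tendsto (fun x => M (c * x) / M x) atTop (𝓝 (c ^ (1 - ρ))) := by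
    intro c hc
    have h1 := (hlim' c hc).div (hlim' 1 one_pos) (by simpa using hC.ne')
    have e : C * c ^ (1 - ρ) / (C * 1 ^ (1 - ρ)) = c ^ (1 - ρ) := by
      rw [Real.one_rpow]; field_simp
    rw [e] at h1
    refine h1.congr' ?_
    filter_upwards [hMpos, eventually_gt_atTop 0] with x hx hx0
    have := hpos x⁻¹ (by positivity)
    simp only [Pi.div_apply]
    rw [one_mul]
    exact mul_div_mul_left _ _ (by positivity)
  let L : ℝ → ℝ := fun x => if 0 < M x then M x / x ^ (1 - ρ) else 1
  have hL : ∀ᶠ x in atTop, L x = M x / x ^ (1 - ρ) := by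
    filter_upwards [hMpos] with x hx
    simp only [L]; rw [if_pos hx]
  refine ⟨L, ?_, ?_, ?_⟩
  · intro x hx
    simp only [L]
    split_ifs with h
    · positivity
    · exact one_pos
  · intro c hc
    have h1 := (hratio c hc).div_const (c ^ (1 - ρ))
    have hcp : 0 < c ^ (1 - ρ) := by positivity
    rw [div_self hcp.ne'] at h1
    refine h1.congr' ?_
    have hcx : Tendsto (fun x => c * x) atTop atTop := tendsto_id.const_mul_atTop hc
    filter_upwards [hL, hcx.eventually hL, hMpos, eventually_gt_atTop 0] with x a b hx hx0
    rw [a, b, Real.mul_rpow hc.le hx0.le]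
    have : 0 < x ^ (1 - ρ) := by positivity
    field_simp
  · refine tendsto_const_nhds.congr' ?_
    filter_upwards [hL, hMpos, eventually_gt_atTop 0] with x a hx hx0
    rw [a]
    have : 0 < x ^ (1 - ρ) := by positivity
    change 1 = M x / _
    field_simp

lemma laplace_layer (μ : Measure ℝ) [IsFiniteMeasure μ] (h0 : ∀ᵐ x ∂μ, 0 < x)
    (s lam : ℝ) (hs : 0 < s) (hl : 0 < lam) :
    ∫ x, (1 - exp (-(s / lam * x))) ∂μ = ∫ y in Ioi 0, exp (-y) * μ.real (Ioi (lam * (y / s))) := by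
  have hInt : ∀ z : ℝ, ∫ t in (0:ℝ)..z, exp (-t) = 1 - exp (-z) := by
    intro z
    have := intervalIntegral.integral_eq_sub_of_hasDerivAt (a := 0) (b := z) (f := fun t => -exp (-t))
      (f' := fun t => exp (-t)) (fun t _ => by
        have := ((hasDerivAt_neg t).exp).neg
        rw [mul_neg_one, neg_neg] at this
        exact this) ((by fun_prop : Continuous fun t : ℝ => exp (-t)).intervalIntegrable _ _)
    rw [this]; simp; ring
  have hlc := lintegral_comp_eq_lintegral_meas_lt_mul μ (f := fun x => s / lam * x)
    (g := fun t => exp (-t)) (by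
      filter_upwards [h0] with x hx
      simp only [Pi.zero_apply]; positivity) (by fun_prop)
    (fun t _ => (by fun_prop : Continuous fun t : ℝ => exp (-t)).intervalIntegrable _ _)
    (Eventually.of_forall fun t => (exp_pos _).le)
  simp_rw [hInt] at hlc
  rw [integral_eq_lintegral_of_nonneg_ae, hlc, integral_eq_lintegral_of_nonneg_ae]
  · congr 1
    refine lintegral_congr fun y => ?_
    have : {a : ℝ | y < s / lam * a} = Ioi (lam * (y / s)) := by
      ext a
      simp only [mem_ofPred_eq, mem_Ioi]
      rw [← mul_div_assoc, div_lt_iff₀ hs, div_mul_eq_mul_div, lt_div_iff₀ hl, mul_comm y, mul_comm s]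
    rw [this, ENNReal.ofReal_mul (exp_pos _).le, mul_comm]
    simp [Measure.real]
  · exact Eventually.of_forall fun y => by simp only [Pi.zero_apply]; positivity
  · refine Measurable.aestronglyMeasurable ?_
    refine Measurable.mul (by fun_prop) ?_
    have : Antitone fun y : ℝ => μ.real (Ioi (lam * (y / s))) := by
      intro a b hab
      refine measureReal_mono (Ioi_subset_Ioi ?_)
      gcongr
    exact this.measurable
  · filter_upwards [h0] with x hx
    have : exp (-(s / lam * x)) ≤ 1 := by
      rw [Real.exp_le_one_iff]
      have : 0 < s / lam * x := by positivity
      linarith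
    simp only [Pi.zero_apply]; linarith
  · exact (by fun_prop : Measurable fun x : ℝ => 1 - exp (-(s / lam * x))).aestronglyMeasurable

lemma mass_lim (μ : Measure ℝ) [IsFiniteMeasure μ] (h0 : ∀ᵐ x ∂μ, 0 < x) :
    Tendsto (fun s : ℝ => ∫ x, (1 - exp (-(s * x))) ∂μ) atTop (𝓝 (μ.real univ)) := by
  have e : μ.real univ = ∫ _, (1:ℝ) ∂μ := by simp
  rw [e]
  refine tendsto_integral_filter_of_dominated_convergence (fun _ => 1) ?_ ?_ (integrable_const _) ?_
  · exact Eventually.of_forall fun s => by fun_prop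
  · filter_upwards [eventually_ge_atTop 0] with s hs
    filter_upwards [h0] with x hx
    have : exp (-(s * x)) ≤ 1 := by
      rw [Real.exp_le_one_iff]; nlinarith [mul_nonneg hs hx.le]
    rw [Real.norm_of_nonneg (by linarith)]
    linarith [exp_pos (-(s * x))]
  · filter_upwards [h0] with x hx
    have h1 : Tendsto (fun s : ℝ => exp (-(s * x))) atTop (𝓝 0) :=
      Real.tendsto_exp_neg_atTop_nhds_zero.comp (tendsto_id.atTop_mul_const hx)
    simpa using h1.const_sub 1

lemma zero_lim (μ : Measure ℝ) [IsFiniteMeasure μ] (h0 : ∀ᵐ x ∂μ, 0 < x) :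
    Tendsto (fun s : ℝ => ∫ x, (1 - exp (-(s * x))) ∂μ) (𝓝[>] 0) (𝓝 0) := by
  have e : (0:ℝ) = ∫ _, (0:ℝ) ∂μ := by simp
  conv => arg 3; rw [e]
  refine tendsto_integral_filter_of_dominated_convergence (fun _ => 1) ?_ ?_ (integrable_const _) ?_
  · exact Eventually.of_forall fun s => by fun_prop
  · filter_upwards [self_mem_nhdsWithin] with s hs
    filter_upwards [h0] with x hx
    have hs : 0 < s := hs
    have : exp (-(s * x)) ≤ 1 := by
      rw [Real.exp_le_one_iff]; nlinarith [mul_nonneg hs.le hx.le]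
    rw [Real.norm_of_nonneg (by linarith)]
    linarith [exp_pos (-(s * x))]
  · filter_upwards [h0] with x hx
    have : Continuous fun s : ℝ => 1 - exp (-(s * x)) := by fun_prop
    simpa using (this.tendsto 0).mono_left nhdsWithin_le_nhds

lemma phi_props (μ : Measure ℝ) [IsFiniteMeasure μ] (h0 : ∀ᵐ x ∂μ, 0 < x) (hμ : μ ≠ 0)
    (φ : ℝ → ℝ) (hφ : ∀ s, φ s = ∫ x, (1 - exp (-(s * x))) ∂μ) :
    (∀ s, 0 < s → 0 < φ s) ∧ (∀ s s', 0 < s → s ≤ s' → φ s ≤ φ s') ∧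
    (∀ c s, 1 ≤ c → 0 < s → φ (c * s) ≤ c * φ s) := by
  refine ⟨?_, ?_, ?_⟩
  · intro s hs
    have hnn : 0 ≤ᵐ[μ] fun x => 1 - exp (-(s * x)) := by
      filter_upwards [h0] with x hx
      have : exp (-(s * x)) ≤ 1 := by
        rw [Real.exp_le_one_iff]; nlinarith [mul_nonneg hs.le hx.le]
      simp only [Pi.zero_apply]; linarith
    rw [hφ]
    refine lt_of_le_of_ne (integral_nonneg_of_ae hnn) fun h => hμ ?_
    have := (integral_eq_zero_iff_of_nonneg_ae hnn (integrable_one_sub_exp μ h0 s hs.le)).1 h.symm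
    have hF : ∀ᵐ x ∂μ, False := by
      filter_upwards [this, h0] with x h1 hx
      have : exp (-(s * x)) < 1 := by
        rw [Real.exp_lt_one_iff]; nlinarith [mul_pos hs hx]
      simp only [Pi.zero_apply] at h1
      linarith
    simpa using hF
  · intro s s' hs hss
    rw [hφ, hφ]
    refine integral_mono_ae (integrable_one_sub_exp μ h0 s hs.le)
      (integrable_one_sub_exp μ h0 s' (hs.le.trans hss)) ?_
    filter_upwards [h0] with x hx
    have : exp (-(s' * x)) ≤ exp (-(s * x)) := by
      rw [Real.exp_le_exp]; nlinarith
    linarith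
  · intro c s hc hs
    rw [hφ, hφ, ← integral_const_mul]
    refine integral_mono_ae (integrable_one_sub_exp μ h0 _ (by positivity))
      ((integrable_one_sub_exp μ h0 s hs.le).const_mul c) ?_
    filter_upwards [h0] with x hx
    have hb := one_add_mul_self_le_rpow_one_add (s := exp (-(s * x)) - 1) (p := c)
      (by linarith [exp_pos (-(s * x))]) hc
    have e : (1 + (exp (-(s * x)) - 1)) ^ c = exp (-(c * s * x)) := by
      rw [add_sub_cancel, ← Real.exp_mul]; ring_nf
    rw [e] at hb
    linarith

def gst (G : ℝ → ℝ) (s : ℝ) : ℝ := ∫ y in Ioi 0, exp (-y) * (1 - G (y / s))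

lemma exp_int : IntegrableOn (fun y : ℝ => exp (-y)) (Ioi 0) := by
  simpa using exp_neg_integrableOn_Ioi 0 one_pos

lemma gst_integrable (G : ℝ → ℝ) (hm : Monotone G) (h0 : ∀ x, 0 ≤ G x) (h1 : ∀ x, G x ≤ 1)
    (s : ℝ) (hs : 0 < s) :
    IntegrableOn (fun y => exp (-y) * (1 - G (y / s))) (Ioi 0) := by
  refine Integrable.mono' exp_int ?_ ?_
  · refine Measurable.aestronglyMeasurable (Measurable.mul (by fun_prop) (measurable_const.sub ?_))
    exact hm.measurable.comp (by fun_prop)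
  · refine Eventually.of_forall fun y => ?_
    have a := h0 (y / s)
    have b := h1 (y / s)
    rw [Real.norm_of_nonneg (mul_nonneg (exp_pos _).le (by linarith))]
    exact mul_le_of_le_one_right (exp_pos _).le (by linarith)

lemma gst_strict (G : ℝ → ℝ) (hm : Monotone G) (h0 : ∀ x, 0 ≤ G x) (h1 : ∀ x, G x ≤ 1)
    (hlim : Tendsto G atTop (𝓝 1)) (hnt : ∃ x, 0 < x ∧ G x < 1)
    (s s' : ℝ) (hs : 0 < s) (hss : s < s') : gst G s < gst G s' := by
  by_contra hcon
  have hs' := hs.trans hss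
  have i1 := gst_integrable G hm h0 h1 s hs
  have i2 := gst_integrable G hm h0 h1 s' hs'
  have hnn : 0 ≤ᵐ[volume.restrict (Ioi 0)] fun y : ℝ => exp (-y) * (1 - G (y / s')) -
      exp (-y) * (1 - G (y / s)) := by
    filter_upwards [ae_restrict_mem measurableSet_Ioi] with y hy
    have hy : 0 < y := hy
    have : G (y / s') ≤ G (y / s) := hm (by gcongr)
    simp only [Pi.zero_apply]
    nlinarith [mul_nonneg (exp_pos (-y)).le (sub_nonneg.2 this)]
  have hz : ∫ y in Ioi (0:ℝ), (exp (-y) * (1 - G (y / s')) - exp (-y) * (1 - G (y / s))) = 0 := by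
    refine le_antisymm ?_ (integral_nonneg_of_ae hnn)
    rw [integral_sub i2 i1]
    unfold gst at hcon
    linarith
  have hae := (integral_eq_zero_iff_of_nonneg_ae hnn (i2.sub i1)).1 hz
  have hae2 : ∀ᵐ y : ℝ, 0 < y → G (y / s) = G (y / s') := by
    filter_upwards [(ae_restrict_iff' measurableSet_Ioi).1 hae] with y hy hy0
    have := hy hy0
    simp only [Pi.zero_apply] at this
    have e : exp (-y) * (G (y / s) - G (y / s')) = 0 := by linarith
    rcases mul_eq_zero.1 e with h | h
    · exact absurd h (exp_pos _).ne'
    · linarith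
  have step : ∀ w z, 0 < w → w < z → G (w / s) ≤ G (z / s') := by
    intro w z hw hwz
    obtain ⟨y, hy, hwy, hyz⟩ := (Measure.dense_of_ae hae2).exists_between hwz
    have hy := hy (hw.trans hwy)
    calc G (w / s) ≤ G (y / s) := hm (by gcongr)
      _ = G (y / s') := hy
      _ ≤ G (z / s') := hm (by gcongr)
  set θ := Real.sqrt (s' / s) with hθ
  have hθ1 : 1 < θ := by
    rw [hθ, Real.lt_sqrt (by norm_num)]; rw [one_pow, one_lt_div hs]; exact hss
  have hθθ : θ * θ = s' / s := Real.mul_self_sqrt (by positivity)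
  have step2 : ∀ x, 0 < x → G (θ * x) ≤ G x := by
    intro x hx
    have hθ0 : 0 < θ := by linarith
    have := step (θ * x * s) (s' * x) (by positivity) (by
      have : s' = θ * θ * s := by rw [hθθ]; field_simp
      rw [this]
      have : 0 < θ * x * s := by positivity
      nlinarith)
    rwa [mul_div_cancel_right₀ _ hs.ne', mul_div_cancel_left₀ _ hs'.ne'] at this
  obtain ⟨x, hx, hGx⟩ := hnt
  have step3 : ∀ n : ℕ, G (θ ^ n * x) ≤ G x := by
    intro n
    induction n with
    | zero => simp
    | succ k ih =>
      refine le_trans ?_ ih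
      have := step2 (θ ^ k * x) (by positivity)
      rwa [← mul_assoc, ← pow_succ'] at this
  have hT : Tendsto (fun n : ℕ => G (θ ^ n * x)) atTop (𝓝 1) :=
    hlim.comp ((tendsto_pow_atTop_atTop_of_one_lt hθ1).atTop_mul_const hx)
  have := le_of_tendsto' hT step3
  linarith

lemma gst_bounds (G : ℝ → ℝ) (hm : Monotone G) (h0 : ∀ x, 0 ≤ G x) (h1 : ∀ x, G x ≤ 1)
    (hlim : Tendsto G atTop (𝓝 1)) (hnt : ∃ x, 0 < x ∧ G x < 1)
    (s : ℝ) (hs : 0 < s) : 0 < gst G s ∧ gst G s < 1 := by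
  have hnn : ∀ s, 0 ≤ gst G s := fun s => 
    integral_nonneg fun y => mul_nonneg (exp_pos _).le (by linarith [h1 (y / s)])
  have hle : ∀ s, 0 < s → gst G s ≤ 1 := by
    intro s hs
    rw [← integral_exp_neg_Ioi_zero]
    refine integral_mono (gst_integrable G hm h0 h1 s hs) exp_int fun y => ?_
    exact mul_le_of_le_one_right (exp_pos _).le (by linarith [h0 (y / s)])
  exact ⟨(hnn (s / 2)).trans_lt (gst_strict G hm h0 h1 hlim hnt _ _ (by positivity) (by linarith)),
    (gst_strict G hm h0 h1 hlim hnt s (2 * s) hs (by linarith)).trans_le (hle _ (by positivity))⟩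

theorem const_kernel_scaling_necessity
    -- ν₀ : finite positive measure on (0,∞)
    (ν₀ : Measure ℝ) [IsFiniteMeasure ν₀] (hν₀supp : ν₀ (Set.Iic 0) = 0)
    -- desingularized Laplace transform of ν₀
    (φ₀ : ℝ → ℝ) (hφ₀ : ∀ s : ℝ, φ₀ s = ∫ x, (1 - Real.exp (-(s * x))) ∂ν₀)
    -- (ν t) is the solution with kernel K = 2 and initial data ν₀,
    -- uniquely determined by its desingularized Laplace transform
    (ν : ℝ → Measure ℝ)
    (hsol : ∀ t : ℝ, 0 ≤ t → (ν t) (Set.Iic 0) = 0 ∧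
      ∀ s : ℝ, 0 < s →
        ∫ x, (1 - Real.exp (-(s * x))) ∂(ν t) = φ₀ s / (1 + t * φ₀ s))
    -- normalized (size-biased) distribution function F(t,x)
    (F : ℝ → ℝ → ℝ)
    (hF : ∀ t : ℝ, 0 < t → ∀ x : ℝ,
      F t x = ((ν t) (Set.Ioc 0 x)).toReal / ((ν t) (Set.Ioi 0)).toReal)
    -- rescaling λ(t) → ∞
    (lam : ℝ → ℝ) (hlam_pos : ∀ t : ℝ, 0 < t → 0 < lam t)
    (hlam : Tendsto lam atTop atTop)
    -- F⋆ : nontrivial probability distribution function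
    (Fstar : ℝ → ℝ)
    (hF_mono : Monotone Fstar)
    (hF_rc : ∀ x : ℝ, ContinuousWithinAt Fstar (Set.Ici x) x)
    (hF_nonneg : ∀ x : ℝ, 0 ≤ Fstar x)
    (hF_one : Tendsto Fstar atTop (𝓝 1))
    (hF_nontrivial : ∃ x : ℝ, 0 < x ∧ Fstar x < 1)
    -- convergence F(t, λ(t) x) → F⋆(x) at continuity points of F⋆
    (hconv : ∀ x : ℝ, 0 < x → ContinuousAt Fstar x →
      Tendsto (fun t => F t (lam t * x)) atTop (𝓝 (Fstar x))) :
    -- conclusion: ∫₀^x y ν₀(dy) ~ x^{1-ρ} L(x) as x → ∞, with 0 < ρ ≤ 1, L slowly varying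
    ∃ ρ : ℝ, ρ ∈ Set.Ioc (0:ℝ) 1 ∧ ∃ L : ℝ → ℝ,
      (∀ x : ℝ, 0 < x → 0 < L x) ∧
      (∀ c : ℝ, 0 < c → Tendsto (fun x => L (c * x) / L x) atTop (𝓝 1)) ∧
      Tendsto (fun x => (∫ y in Set.Ioc (0:ℝ) x, y ∂ν₀) / (x ^ (1 - ρ) * L x))
        atTop (𝓝 1) := by
  have hpos_ae : ∀ μ : Measure ℝ, μ (Set.Iic 0) = 0 → ∀ᵐ x ∂μ, 0 < x := by
    intro μ h
    have := compl_mem_ae_iff.2 h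
    filter_upwards [this] with x hx
    simpa using hx
  have h0 := hpos_ae ν₀ hν₀supp
  have hF1 : ∀ x, Fstar x ≤ 1 := fun x =>
    ge_of_tendsto hF_one ((eventually_ge_atTop x).mono fun y hy => hF_mono hy)
  have hcount := hF_mono.countable_not_continuousAt
  obtain ⟨x1, hx1pos, hx1c, hx1F⟩ : ∃ x, 0 < x ∧ ContinuousAt Fstar x ∧ 0 < Fstar x := by
    obtain ⟨a, ha⟩ := ((hF_one.eventually_const_lt (zero_lt_one)).and
      (eventually_gt_atTop (0:ℝ))).exists_forall_of_atTop
    obtain ⟨y, hy, h1, -⟩ := (hcount.dense_compl ℝ).exists_between (lt_add_one a)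
    have := ha y h1.le
    exact ⟨y, this.2, by simpa using hy, this.1⟩
  have hgood : ∀ᶠ t in atTop, 0 < t ∧ IsFiniteMeasure (ν t) ∧ 0 < (ν t).real (Ioi 0) := by
    filter_upwards [(hconv x1 hx1pos hx1c).eventually_const_lt hx1F, eventually_gt_atTop 0]
      with t h1 ht
    rw [hF t ht] at h1
    have h2 : ((ν t) (Set.Ioi 0)).toReal ≠ 0 := by
      intro h; rw [h, div_zero] at h1; exact lt_irrefl _ h1
    refine ⟨ht, ⟨?_⟩, lt_of_le_of_ne ENNReal.toReal_nonneg h2.symm⟩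
    have h3 : (ν t) (Ioi 0) ≠ ⊤ := by
      intro h; rw [h] at h2; simp at h2
    rw [← Iic_union_Ioi (a := (0:ℝ))]
    refine (measure_union_le _ _).trans_lt ?_
    rw [(hsol t ht.le).1, zero_add]
    exact h3.lt_top
  set n := ν₀.real univ with hn
  have hn0 : 0 ≤ n := measureReal_nonneg
  have hφn : Tendsto φ₀ atTop (𝓝 n) := (mass_lim ν₀ h0).congr fun s => (hφ₀ s).symm
  have hmass : ∀ t, 0 < t → IsFiniteMeasure (ν t) → (ν t).real (Ioi 0) = n / (1 + t * n) := by
    intro t ht hfin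
    have e : (ν t).real (Ioi 0) = (ν t).real univ := by
      refine measureReal_congr ?_
      filter_upwards [hpos_ae _ (hsol t ht.le).1] with x hx
      apply propext
      exact ⟨fun _ => trivial, fun _ => hx⟩
    rw [e]
    refine tendsto_nhds_unique (mass_lim (ν t) (hpos_ae _ (hsol t ht.le).1)) ?_
    have h1 : Tendsto (fun s => φ₀ s / (1 + t * φ₀ s)) atTop (𝓝 (n / (1 + t * n))) :=
      hφn.div ((hφn.const_mul t).const_add 1) (by positivity)
    refine h1.congr' ?_
    filter_upwards [eventually_gt_atTop 0] with s hs
    exact ((hsol t ht.le).2 s hs).symm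
  have hnpos : 0 < n := by
    obtain ⟨t, ht, hfin, hN⟩ := hgood.exists
    rw [hmass t ht hfin] at hN
    refine lt_of_le_of_ne hn0 fun h => ?_
    rw [← h] at hN; simp at hN
  have hν0 : ν₀ ≠ 0 := by
    intro h
    have : n = 0 := by rw [hn, h]; simp
    linarith
  obtain ⟨hφpos, hφmono, hφsub⟩ := phi_props ν₀ h0 hν0 φ₀ hφ₀
  have hφzero : Tendsto φ₀ (𝓝[>] 0) (𝓝 0) := (zero_lim ν₀ h0).congr fun s => (hφ₀ s).symm
  have hgb := gst_bounds Fstar hF_mono hF_nonneg hF1 hF_one hF_nontrivial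
  have hgs := gst_strict Fstar hF_mono hF_nonneg hF1 hF_one hF_nontrivial
  have hcomp : ∀ t, 0 < t → IsFiniteMeasure (ν t) → 0 < (ν t).real (Ioi 0) → ∀ x, 0 ≤ x →
      (ν t).real (Ioi x) / (ν t).real (Ioi 0) = 1 - F t x := by
    intro t ht hfin hN x hx
    have e : (ν t).real (Ioi 0) = (ν t).real (Ioc 0 x) + (ν t).real (Ioi x) := by
      rw [← Ioc_union_Ioi_eq_Ioi hx, measureReal_union _ measurableSet_Ioi]
      rw [Set.disjoint_left]
      intro y hy hy'
      exact absurd hy.2 (not_le.2 hy')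
    rw [hF t ht]
    change _ = 1 - (ν t).real (Ioc 0 x) / (ν t).real (Ioi 0)
    rw [eq_sub_iff_add_eq, ← add_div, add_comm, ← e, div_self hN.ne']
  have hlap : ∀ s, 0 < s → Tendsto (fun t => (∫ x, (1 - exp (-(s / lam t * x))) ∂(ν t)) /
      (ν t).real (Ioi 0)) atTop (𝓝 (gst Fstar s)) := by
    intro s hs
    have h1 : Tendsto (fun t => ∫ y in Ioi 0, exp (-y) *
        ((ν t).real (Ioi (lam t * (y / s))) / (ν t).real (Ioi 0))) atTop (𝓝 (gst Fstar s)) := by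
      unfold gst
      refine tendsto_integral_filter_of_dominated_convergence (fun y => exp (-y)) ?_ ?_ exp_int ?_
      · filter_upwards [hgood] with t ⟨ht, hfin, hN⟩
        refine Measurable.aestronglyMeasurable ?_
        refine Measurable.mul (by fun_prop) (Measurable.div_const ?_ _)
        have hl := hlam_pos t ht
        have : Antitone fun y : ℝ => (ν t).real (Ioi (lam t * (y / s))) := by
          intro a b hab
          refine measureReal_mono (Ioi_subset_Ioi ?_)
          gcongr
        exact this.measurable
      · filter_upwards [hgood] with t ⟨ht, hfin, hN⟩
        filter_upwards [ae_restrict_mem measurableSet_Ioi] with y hy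
        have hy : 0 < y := hy
        have hl := hlam_pos t ht
        rw [Real.norm_of_nonneg (by positivity)]
        refine mul_le_of_le_one_right (exp_pos _).le ?_
        rw [div_le_one hN]
        exact measureReal_mono (Ioi_subset_Ioi (by positivity))
      · have hc : ∀ᵐ y : ℝ, ContinuousAt Fstar (y / s) := by
          have : {y : ℝ | ¬ ContinuousAt Fstar (y / s)}.Countable := by
            have := hcount.preimage_of_injOn (f := fun y : ℝ => y / s)
              (fun a _ b _ h => by simpa [hs.ne'] using h)
            exact this
          have := this.measure_zero volume
          exact this
        filter_upwards [ae_restrict_of_ae hc, ae_restrict_mem measurableSet_Ioi] with y hyc hy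
        have hy : 0 < y := hy
        have h2 := ((hconv (y / s) (by positivity) hyc).const_sub 1).const_mul (exp (-y))
        refine h2.congr' ?_
        filter_upwards [hgood] with t ⟨ht, hfin, hN⟩
        have hl := hlam_pos t ht
        rw [hcomp t ht hfin hN _ (by positivity)]
    refine h1.congr' ?_
    filter_upwards [hgood] with t ⟨ht, hfin, hN⟩
    rw [laplace_layer (ν t) (hpos_ae _ (hsol t ht.le).1) s (lam t) hs (hlam_pos t ht),
      ← integral_div]
    simp_rw [mul_div_assoc]
  have hr : ∀ s, 0 < s → Tendsto (fun t => t * φ₀ (s / lam t) / (1 + t * φ₀ (s / lam t))) atTop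
      (𝓝 (gst Fstar s)) := by
    intro s hs
    have h1 : Tendsto (fun t : ℝ => 1 - (1 + t * n)⁻¹) atTop (𝓝 1) := by
      have : Tendsto (fun t : ℝ => 1 + t * n) atTop atTop :=
        tendsto_atTop_add_const_left _ _ (tendsto_id.atTop_mul_const hnpos)
      simpa using (tendsto_inv_atTop_zero.comp this).const_sub 1
    have h2 := (hlap s hs).mul h1
    rw [mul_one] at h2
    refine h2.congr' ?_
    filter_upwards [hgood] with t ⟨ht, hfin, hN⟩
    have hl := hlam_pos t ht
    rw [(hsol t ht.le).2 _ (by positivity), hmass t ht hfin]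
    have := hφpos (s / lam t) (by positivity)
    field_simp
    ring
  have hh : ∀ s, 0 < s → Tendsto (fun t => t * φ₀ (s / lam t)) atTop
      (𝓝 (gst Fstar s / (1 - gst Fstar s))) := by
    intro s hs
    have hb := hgb s hs
    have h1 := (hr s hs).div ((hr s hs).const_sub 1) (by linarith)
    refine h1.congr' ?_
    filter_upwards [eventually_gt_atTop 0] with t ht
    have hl := hlam_pos t ht
    have := hφpos (s / lam t) (by positivity)
    simp only [Pi.div_apply]
    have h3 : 0 < 1 + t * φ₀ (s / lam t) := by positivity
    rw [one_sub_div h3.ne', add_sub_cancel_right, div_div_div_cancel_right₀ h3.ne', div_one]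
  obtain ⟨ρ, hρ0, hρ1, hrv⟩ := rv_of_conv φ₀ (fun s => gst Fstar s / (1 - gst Fstar s)) lam hφpos
    hφmono hφsub hφzero hlam_pos
    (fun s hs => div_pos (hgb s hs).1 (by linarith [(hgb s hs).2]))
    (fun s s' hs hss => by
      have a := hgb s hs
      have b := hgb s' (hs.trans hss)
      have c := hgs s s' hs hss
      rw [div_lt_div_iff₀ (by linarith) (by linarith)]
      nlinarith) hh
  exact ⟨ρ, ⟨hρ0, hρ1⟩, final_step ν₀ h0 φ₀ hφ₀ hφpos ρ hρ0 hρ1 hrv⟩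
end
end

section
/- Sufficiency part of the scaling theorem for the constant kernel: Let ν₀ be a finite positive measure on (0,∞) and let (ν_t)_{t≥0} be the solution of Smoluchowski's coagulation equation with kernel K=2 and initial data ν₀, and set F(t,x) = ν_t((0,x])/ν_t((0,∞)) for t > 0. Suppose there exist ρ ∈ (0,1] and a function L slowly varying at infinity such that ∫₀^x y ν₀(dy) ~ x^{1−ρ} L(x) as x → ∞. Then there is a strictly increasing rescaling λ(t) with λ(t) → ∞ as t → ∞ such that lim_{t→∞} F(t, λ(t)x) = F_ρ(x) for every x ∈ (0,∞), where F_ρ is the Mittag-Leffler distribution function. -/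
/-!
Sufficiency part of the scaling theorem for Smoluchowski's coagulation equation
with constant kernel K = 2: attraction to the Mittag-Leffler distribution.
-/

open MeasureTheory Filter Topology Set Real

noncomputable section

/-- The Mittag-Leffler distribution function
`F_ρ(x) = Σ_{k=1}^∞ (−1)^{k+1} x^{ρk} / Γ(1+ρk)`. -/
def mittagLefflerCDF (ρ x : ℝ) : ℝ :=
  ∑' k : ℕ, (-1 : ℝ) ^ k * x ^ (ρ * ((k : ℝ) + 1)) / Real.Gamma (1 + ρ * ((k : ℝ) + 1))

lemma gamma_lower (a B : ℝ) (ha : 0 ≤ a) (hB : 0 < B) : B ^ a * exp (-B) ≤ Real.Gamma (1 + a) := by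
  have hInteg : IntegrableOn (fun x => Real.exp (-x) * x ^ a) (Set.Ioi 0) volume := by
    have := Real.GammaIntegral_convergent (s := 1 + a) (by linarith)
    simpa using this
  have h1 : Real.Gamma (1 + a) = ∫ t in Ioi (0:ℝ), exp (-t) * t ^ a := by
    rw [Real.Gamma_eq_integral (by linarith)]
    simp
  have h2 : B ^ a * exp (-B) = ∫ t in Ioi B, exp (-t) * B ^ a := by
    rw [integral_mul_const, integral_exp_neg_Ioi, mul_comm]
  have hsub : Ioi B ⊆ Ioi (0:ℝ) := Ioi_subset_Ioi hB.le
  rw [h1, h2]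
  calc ∫ t in Ioi B, exp (-t) * B ^ a ≤ ∫ t in Ioi B, exp (-t) * t ^ a := by
        apply setIntegral_mono_on _ (hInteg.mono_set hsub) measurableSet_Ioi
        · intro t ht
          have : B < t := ht
          gcongr
        · have := integrableOn_exp_mul_Ioi (a := -1) (by norm_num) B
          simp only [neg_mul, one_mul] at this
          exact this.mul_const _
    _ ≤ _ := by
        apply setIntegral_mono_set hInteg
        · filter_upwards [ae_restrict_mem measurableSet_Ioi] with t ht
          have : (0:ℝ) < t := ht
          simp only [Pi.zero_apply]
          positivity
        · exact hsub.eventuallyLE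

lemma ml_term_bound (a x : ℝ) (ha : 0 ≤ a) (hx : 0 < x) :
    x ^ a / Real.Gamma (1 + a) ≤ exp (3 / 2 * x) * (2 / 3 : ℝ) ^ a := by
  have hG : 0 < Real.Gamma (1 + a) := Real.Gamma_pos_of_pos (by linarith)
  rw [div_le_iff₀ hG]
  have h := gamma_lower a (3 / 2 * x) ha (by positivity)
  calc x ^ a = exp (3 / 2 * x) * (2 / 3 : ℝ) ^ a * ((3 / 2 * x) ^ a * exp (-(3 / 2 * x))) := by
        rw [Real.mul_rpow (by norm_num) hx.le, Real.exp_neg]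
        have : (2 / 3 : ℝ) ^ a * (3 / 2 : ℝ) ^ a = 1 := by
          rw [← Real.mul_rpow (by norm_num) (by norm_num)]; norm_num
        have h3 := Real.exp_pos (3 / 2 * x)
        field_simp
        linear_combination (-1) * this
    _ ≤ _ := by gcongr

lemma ml_summable_geom (ρ : ℝ) (hρ : 0 < ρ) (q : ℝ) (hq0 : 0 < q) (hq : q < 1) :
    HasSum (fun k : ℕ => (q : ℝ) ^ (ρ * ((k : ℝ) + 1))) (q ^ ρ / (1 - q ^ ρ)) := by
  have h1 : q ^ ρ < 1 := Real.rpow_lt_one hq0.le hq hρ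
  have h2 := (hasSum_geometric_of_lt_one (Real.rpow_nonneg hq0.le ρ) h1).mul_left (q ^ ρ)
  rw [div_eq_mul_inv]
  have e : (fun k : ℕ => (q : ℝ) ^ (ρ * ((k : ℝ) + 1))) = fun i : ℕ => q ^ ρ * (q ^ ρ) ^ i := by
    ext k
    rw [Real.rpow_mul hq0.le, Real.rpow_add_one (by positivity), Real.rpow_natCast, mul_comm]
  rw [e]
  exact h2

lemma ml_term_norm (ρ x : ℝ) (hρ : 0 < ρ) (hx : 0 < x) (k : ℕ) :
    ‖(-1 : ℝ) ^ k * x ^ (ρ * ((k : ℝ) + 1)) / Real.Gamma (1 + ρ * ((k : ℝ) + 1))‖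
      = x ^ (ρ * ((k : ℝ) + 1)) / Real.Gamma (1 + ρ * ((k : ℝ) + 1)) := by
  have hG : 0 < Real.Gamma (1 + ρ * ((k : ℝ) + 1)) := Real.Gamma_pos_of_pos (by positivity)
  rw [norm_div, norm_mul, norm_pow, norm_neg, norm_one, one_pow, one_mul, Real.norm_of_nonneg hG.le,
    Real.norm_of_nonneg (by positivity)]

lemma ml_bound (ρ x : ℝ) (hρ : 0 < ρ) (hx : 0 < x) :
    ‖mittagLefflerCDF ρ x‖ ≤ ((2/3:ℝ) ^ ρ / (1 - (2/3:ℝ) ^ ρ)) * exp (3 / 2 * x) := by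
  have h := (ml_summable_geom ρ hρ (2/3) (by norm_num) (by norm_num)).mul_left (exp (3 / 2 * x))
  rw [mul_comm]
  refine tsum_of_norm_bounded h fun k => ?_
  rw [ml_term_norm ρ x hρ hx]
  exact ml_term_bound _ _ (by positivity) hx

lemma ml_cont (ρ : ℝ) (hρ : 0 < ρ) : ContinuousOn (mittagLefflerCDF ρ) (Ioi 0) := by
  intro x hx
  have hx : 0 < x := hx
  have : ContinuousOn (mittagLefflerCDF ρ) (Ioo 0 (x + 1)) := by
    unfold mittagLefflerCDF
    refine continuousOn_tsum (u := fun k : ℕ => exp (3 / 2 * (x+1)) * (2 / 3 : ℝ) ^ (ρ * ((k:ℝ) + 1))) ?_ ?_ ?_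
    · intro k
      apply ContinuousOn.div_const
      apply ContinuousOn.mul continuousOn_const
      intro y hy
      exact (Real.continuousAt_rpow_const _ _ (Or.inl hy.1.ne')).continuousWithinAt
    · exact (ml_summable_geom ρ hρ (2/3) (by norm_num) (by norm_num)).summable.mul_left _
    · intro k y hy
      rw [ml_term_norm ρ y hρ hy.1]
      refine (ml_term_bound _ _ (by positivity) hy.1).trans ?_
      gcongr
      exact hy.2.le
  exact (this.continuousAt (Ioo_mem_nhds hx (by linarith))).continuousWithinAt

lemma ml_laplace (ρ : ℝ) (hρ : 0 < ρ) (s : ℝ) (hs : 1 < s) :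
    ∫ x in Ioi (0:ℝ), exp (-(s * x)) * mittagLefflerCDF ρ x = s⁻¹ * (1 / (1 + s ^ ρ)) := by
  have hs0 : 0 < s := by linarith
  have key : ∀ k : ℕ, ∫ x in Ioi (0:ℝ), exp (-(s * x)) * (x ^ (ρ * ((k : ℝ) + 1)) / Real.Gamma (1 + ρ * ((k : ℝ) + 1)))
      = s⁻¹ * (s⁻¹) ^ (ρ * ((k : ℝ) + 1)) := by
    intro k
    have hG : 0 < Real.Gamma (1 + ρ * ((k : ℝ) + 1)) := Real.Gamma_pos_of_pos (by positivity)
    have := Real.integral_rpow_mul_exp_neg_mul_Ioi (a := 1 + ρ * ((k : ℝ) + 1)) (r := s) (by positivity) hs0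
    rw [add_sub_cancel_left] at this
    simp_rw [← mul_div_assoc]
    rw [integral_div]
    simp_rw [mul_comm (exp _)]
    rw [this, mul_div_assoc, div_self hG.ne', mul_one, Real.rpow_add (by positivity), Real.rpow_one]
    simp
  have hInteg : ∀ k : ℕ, IntegrableOn (fun x => exp (-(s * x)) * (x ^ (ρ * ((k : ℝ) + 1)) / Real.Gamma (1 + ρ * ((k : ℝ) + 1)))) (Ioi 0) := by
    intro k
    by_contra hcon
    have h := key k
    rw [integral_undef hcon] at h
    have : 0 < s⁻¹ * (s⁻¹) ^ (ρ * ((k : ℝ) + 1)) := by positivity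
    linarith
  have hq := ml_summable_geom ρ hρ s⁻¹ (by positivity) (inv_lt_one_of_one_lt₀ hs)
  have H := hasSum_integral_of_summable_integral_norm (μ := volume.restrict (Ioi (0:ℝ)))
    (F := fun (k : ℕ) x => exp (-(s * x)) * ((-1 : ℝ) ^ k * x ^ (ρ * ((k : ℝ) + 1)) / Real.Gamma (1 + ρ * ((k : ℝ) + 1)))) ?_ ?_
  · have e1 : ∫ x in Ioi (0:ℝ), exp (-(s * x)) * mittagLefflerCDF ρ x = ∫ x in Ioi (0:ℝ), ∑' k : ℕ, exp (-(s * x)) * ((-1 : ℝ) ^ k * x ^ (ρ * ((k : ℝ) + 1)) / Real.Gamma (1 + ρ * ((k : ℝ) + 1))) := by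
      congr 1; ext x
      rw [tsum_mul_left]; rfl
    rw [e1]
    refine H.unique ?_
    have e2 : ∀ k : ℕ, ∫ x in Ioi (0:ℝ), exp (-(s * x)) * ((-1 : ℝ) ^ k * x ^ (ρ * ((k : ℝ) + 1)) / Real.Gamma (1 + ρ * ((k : ℝ) + 1)))
       = (s⁻¹ * (s⁻¹)^ρ) * (-(s⁻¹)^ρ)^k := by
      intro k
      have : ∀ x, exp (-(s * x)) * ((-1 : ℝ) ^ k * x ^ (ρ * ((k : ℝ) + 1)) / Real.Gamma (1 + ρ * ((k : ℝ) + 1))) = (-1)^k * (exp (-(s * x)) * (x ^ (ρ * ((k : ℝ) + 1)) / Real.Gamma (1 + ρ * ((k : ℝ) + 1)))) := by intro x; ring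
      simp_rw [this]
      rw [integral_const_mul, key, Real.rpow_mul (by positivity), Real.rpow_add_one (by positivity), Real.rpow_natCast, neg_pow ((s⁻¹)^ρ)]
      ring
    simp_rw [e2]
    have h1 : (s⁻¹) ^ ρ < 1 := Real.rpow_lt_one (by positivity) (inv_lt_one_of_one_lt₀ hs) hρ
    have h0 : 0 < (s⁻¹) ^ ρ := by positivity
    have h2 := (hasSum_geometric_of_norm_lt_one (ξ := -(s⁻¹)^ρ) (by rw [norm_neg, Real.norm_of_nonneg h0.le]; exact h1)).mul_left (s⁻¹ * (s⁻¹)^ρ)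
    have e3 : s⁻¹ * (1 / (1 + s ^ ρ)) = s⁻¹ * s⁻¹ ^ ρ * (1 - -s⁻¹ ^ ρ)⁻¹ := by
      rw [Real.inv_rpow hs0.le]
      have : 0 < s ^ ρ := by positivity
      have h5 : (1 - -(s ^ ρ)⁻¹) = (1 + s ^ ρ) / s ^ ρ := by
        field_simp
        ring
      rw [h5]
      field_simp
    rw [e3]
    exact h2
  · intro k
    have := (hInteg k).const_mul ((-1)^k)
    refine this.congr (Eventually.of_forall fun x => ?_)
    ring
  · refine (hq.summable.mul_left s⁻¹).congr fun k => ?_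
    rw [← key k]
    refine setIntegral_congr_fun measurableSet_Ioi fun x hx => ?_
    rw [norm_mul, ml_term_norm ρ x hρ hx, Real.norm_of_nonneg (exp_pos _).le]

lemma tauber_integrable (g f : ℝ → ℝ) (C : ℝ)
    (hg : AEStronglyMeasurable g (volume.restrict (Ioi 0)))
    (hgb : ∀ x, 0 < x → ‖g x‖ ≤ C * exp (3 / 2 * x)) (hf : Continuous f) :
    IntegrableOn (fun x => exp (-(2 * x)) * f (exp (-x)) * g x) (Ioi 0) := by
  obtain ⟨B, hB⟩ := (isCompact_Icc (a := (0:ℝ)) (b := 1)).exists_bound_of_continuousOn hf.continuousOn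
  have hi : IntegrableOn (fun x => (B * C) * exp (-(1/2) * x)) (Ioi 0) :=
    (integrableOn_exp_mul_Ioi (a := -(1/2)) (by norm_num) 0).const_mul _
  refine Integrable.mono' hi ?_ ?_
  · refine AEStronglyMeasurable.mul ?_ hg
    exact (by fun_prop : Continuous (fun x => exp (-(2 * x)) * f (exp (-x)))).aestronglyMeasurable
  · filter_upwards [ae_restrict_mem measurableSet_Ioi] with x hx
    have hx : 0 < x := hx
    have h1 := hB (exp (-x)) ⟨(exp_pos _).le, by rw [exp_le_one_iff]; linarith⟩
    have h2 := hgb x hx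
    have hB0 : 0 ≤ B := (norm_nonneg _).trans h1
    rw [norm_mul, norm_mul, Real.norm_of_nonneg (exp_pos _).le]
    calc _ ≤ exp (-(2 * x)) * B * (C * exp (3 / 2 * x)) := by gcongr
      _ = (B * C) * (exp (-(2 * x)) * exp (3 / 2 * x)) := by ring
      _ = _ := by rw [← exp_add]; ring_nf

lemma tauber_diff (g f p : ℝ → ℝ) (C ε : ℝ)
    (hg : AEStronglyMeasurable g (volume.restrict (Ioi 0)))
    (hgb : ∀ x, 0 < x → ‖g x‖ ≤ C * exp (3 / 2 * x)) (hf : Continuous f) (hp : Continuous p)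
    (hfp : ∀ x ∈ Icc (0:ℝ) 1, |p x - f x| ≤ ε) :
    ‖(∫ x in Ioi 0, exp (-(2 * x)) * p (exp (-x)) * g x) -
      (∫ x in Ioi 0, exp (-(2 * x)) * f (exp (-x)) * g x)‖ ≤ 2 * C * ε := by
  have i1 := tauber_integrable g f C hg hgb hf
  have i2 := tauber_integrable g p C hg hgb hp
  rw [← integral_sub i2 i1]
  have hi : IntegrableOn (fun x => (ε * C) * exp (-(1/2) * x)) (Ioi 0) :=
    (integrableOn_exp_mul_Ioi (a := -(1/2)) (by norm_num) 0).const_mul _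
  have : ∫ x in Ioi (0:ℝ), (ε * C) * exp (-(1/2) * x) = 2 * C * ε := by
    rw [integral_const_mul, integral_exp_mul_Ioi (by norm_num)]
    simp; ring
  rw [← this]
  refine norm_integral_le_of_norm_le hi ?_
  filter_upwards [ae_restrict_mem measurableSet_Ioi] with x hx
  have hx : 0 < x := hx
  have h1 := hfp (exp (-x)) ⟨(exp_pos _).le, by rw [exp_le_one_iff]; linarith⟩
  have h2 := hgb x hx
  have hB0 : 0 ≤ ε := (abs_nonneg _).trans h1
  rw [show exp (-(2 * x)) * p (exp (-x)) * g x - exp (-(2 * x)) * f (exp (-x)) * g x =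
    exp (-(2 * x)) * (p (exp (-x)) - f (exp (-x))) * g x by ring]
  rw [norm_mul, norm_mul, Real.norm_of_nonneg (exp_pos _).le]
  calc _ ≤ exp (-(2 * x)) * ε * (C * exp (3 / 2 * x)) := by gcongr; exact h1
      _ = (ε * C) * (exp (-(2 * x)) * exp (3 / 2 * x)) := by ring
      _ = _ := by rw [← exp_add]; ring_nf

lemma tauber_cont {ι : Type*} {l : Filter ι} (G : ι → ℝ → ℝ) (H : ℝ → ℝ) (C : ℝ)
    (hmono : ∀ᶠ i in l, Monotone (G i)) (hbd : ∀ᶠ i in l, ∀ x, 0 < x → ‖G i x‖ ≤ C * exp (3 / 2 * x))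
    (hH : ContinuousOn H (Ioi 0)) (hHb : ∀ x, 0 < x → ‖H x‖ ≤ C * exp (3 / 2 * x))
    (hlap : ∀ n : ℕ, Tendsto (fun i => ∫ x in Ioi (0:ℝ), exp (-(((n:ℝ) + 2) * x)) * G i x) l
      (𝓝 (∫ x in Ioi (0:ℝ), exp (-(((n:ℝ) + 2) * x)) * H x))) (f : ℝ → ℝ) (hf : Continuous f) :
    Tendsto (fun i => ∫ x in Ioi (0:ℝ), exp (-(2 * x)) * f (exp (-x)) * G i x) l
      (𝓝 (∫ x in Ioi (0:ℝ), exp (-(2 * x)) * f (exp (-x)) * H x)) := by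
  have hHm : AEStronglyMeasurable H (volume.restrict (Ioi 0)) :=
    hH.aestronglyMeasurable measurableSet_Ioi
  have hpoly : ∀ p : Polynomial ℝ,
      Tendsto (fun i => ∫ x in Ioi (0:ℝ), exp (-(2 * x)) * p.eval (exp (-x)) * G i x) l
      (𝓝 (∫ x in Ioi (0:ℝ), exp (-(2 * x)) * p.eval (exp (-x)) * H x)) := by
    intro p
    induction p using Polynomial.induction_on' with
    | add p q hp hq =>
      have h := hp.add hq
      rw [← integral_add (tauber_integrable H (fun z => p.eval z) C hHm hHb p.continuous)
        (tauber_integrable H (fun z => q.eval z) C hHm hHb q.continuous)] at h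
      have e : ∀ g : ℝ → ℝ, ∀ x, exp (-(2 * x)) * (p + q).eval (exp (-x)) * g x =
        exp (-(2 * x)) * p.eval (exp (-x)) * g x + exp (-(2 * x)) * q.eval (exp (-x)) * g x := by
        intro g x; rw [Polynomial.eval_add]; ring
      simp_rw [e]
      refine h.congr' ?_
      filter_upwards [hmono, hbd] with i hi hb
      have hm : AEStronglyMeasurable (G i) (volume.restrict (Ioi 0)) :=
        hi.measurable.aestronglyMeasurable
      exact (integral_add (tauber_integrable (G i) (fun z => p.eval z) C hm hb p.continuous)
        (tauber_integrable (G i) (fun z => q.eval z) C hm hb q.continuous)).symm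
    | monomial n a =>
      have e : ∀ g : ℝ → ℝ, ∀ x, exp (-(2 * x)) * (Polynomial.monomial n a).eval (exp (-x)) * g x =
        a * (exp (-(((n:ℝ) + 2) * x)) * g x) := by
        intro g x
        rw [Polynomial.eval_monomial, ← Real.exp_nat_mul,
          show -(((n:ℝ) + 2) * x) = -(2 * x) + n * (-x) by ring, Real.exp_add]
        ring
      simp_rw [e, integral_const_mul]
      exact (hlap n).const_mul a
  rw [Metric.tendsto_nhds]
  intro ε hε
  set D := 2 * |C| + 1 with hD
  have hDpos : 0 < D := by positivity
  have hCD : 2 * C ≤ D := by have := le_abs_self C; linarith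
  obtain ⟨p, hp⟩ := exists_polynomial_near_of_continuousOn 0 1 f hf.continuousOn (ε / (3 * D)) (by positivity)
  have hp' : ∀ x ∈ Icc (0:ℝ) 1, |p.eval x - f x| ≤ ε / (3 * D) := fun x hx => (hp x hx).le
  have hlast : 2 * C * (ε / (3 * D)) ≤ ε / 3 := by
    calc 2 * C * (ε / (3 * D)) ≤ D * (ε / (3 * D)) := by gcongr
      _ = ε / 3 := by field_simp
  have hd1 := tauber_diff H f (fun z => p.eval z) C _ hHm hHb hf p.continuous hp'
  have := (Metric.tendsto_nhds.1 (hpoly p)) (ε / 3) (by positivity)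
  filter_upwards [hmono, hbd, this] with i hi hb h3
  have hm : AEStronglyMeasurable (G i) (volume.restrict (Ioi 0)) :=
    hi.measurable.aestronglyMeasurable
  have hd2 := tauber_diff (G i) f (fun z => p.eval z) C _ hm hb hf p.continuous hp'
  rw [Real.dist_eq] at h3 ⊢
  rw [Real.norm_eq_abs] at hd1 hd2
  rw [abs_lt] at h3 ⊢
  rw [abs_le] at hd1 hd2
  constructor <;> linarith [hd1.1, hd1.2, hd2.1, hd2.2, h3.1, h3.2]

/-- A continuous bump in the variable `e^{-x}`, supported on `a ≤ x ≤ b`. -/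
def tbump (a b z : ℝ) : ℝ := max 0 (z - exp (-b)) * max 0 (exp (-a) - z)

lemma tbump_cont (a b : ℝ) : Continuous (tbump a b) := by unfold tbump; fun_prop

lemma tbump_nonneg (a b z : ℝ) : 0 ≤ tbump a b z := by unfold tbump; positivity

lemma tbump_zero (a b x : ℝ) (h : ¬ (a < x ∧ x < b)) : tbump a b (exp (-x)) = 0 := by
  unfold tbump
  by_cases h1 : a < x
  · have : b ≤ x := by by_contra h2; exact h ⟨h1, by linarith⟩
    have : exp (-x) ≤ exp (-b) := exp_le_exp.2 (by linarith)
    rw [max_eq_left (by linarith), zero_mul]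
  · have : exp (-a) ≤ exp (-x) := exp_le_exp.2 (by linarith)
    rw [max_eq_left (a := (0:ℝ)) (b := exp (-a) - exp (-x)) (by linarith), mul_zero]

lemma tbump_pos (a b x : ℝ) (h1 : a < x) (h2 : x < b) : 0 < tbump a b (exp (-x)) := by
  unfold tbump
  have : exp (-b) < exp (-x) := exp_lt_exp.2 (by linarith)
  have : exp (-x) < exp (-a) := exp_lt_exp.2 (by linarith)
  apply mul_pos <;> apply lt_max_of_lt_right <;> linarith

lemma tbump_int_pos (a b : ℝ) (ha : 0 < a) (hab : a < b) :
    0 < ∫ x in Ioi (0:ℝ), exp (-(2 * x)) * tbump a b (exp (-x)) * 1 := by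
  have hi := tauber_integrable (fun _ => 1) (tbump a b) 1 aestronglyMeasurable_const
    (by intro x hx; simp; positivity) (tbump_cont a b)
  rw [setIntegral_pos_iff_support_of_nonneg_ae _ hi]
  · refine lt_of_lt_of_le ?_ (measure_mono (s := Ioo a b) ?_)
    · simpa using hab
    · intro x hx
      refine ⟨?_, ha.trans hx.1⟩
      have := tbump_pos a b x hx.1 hx.2
      simp only [Function.mem_support]
      positivity
  · refine Eventually.of_forall fun x => ?_
    have := tbump_nonneg a b (exp (-x))
    simp only [Pi.zero_apply]
    positivity

/-- On the support of the bump, a pointwise bound integrates. -/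
lemma tbump_mono (a b C : ℝ) (ha : 0 < a) (g h : ℝ → ℝ)
    (hg : AEStronglyMeasurable g (volume.restrict (Ioi 0)))
    (hgb : ∀ x, 0 < x → ‖g x‖ ≤ C * exp (3 / 2 * x))
    (hh : AEStronglyMeasurable h (volume.restrict (Ioi 0)))
    (hhb : ∀ x, 0 < x → ‖h x‖ ≤ C * exp (3 / 2 * x))
    (hle : ∀ x, a < x → x < b → g x ≤ h x) :
    (∫ x in Ioi (0:ℝ), exp (-(2 * x)) * tbump a b (exp (-x)) * g x) ≤
    ∫ x in Ioi (0:ℝ), exp (-(2 * x)) * tbump a b (exp (-x)) * h x := by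
  refine setIntegral_mono_on (tauber_integrable g _ C hg hgb (tbump_cont a b))
    (tauber_integrable h _ C hh hhb (tbump_cont a b)) measurableSet_Ioi ?_
  intro x hx
  by_cases hc : a < x ∧ x < b
  · have := tbump_nonneg a b (exp (-x))
    have := hle x hc.1 hc.2
    gcongr
  · rw [tbump_zero a b x hc]; simp

/-- Tauberian lemma -/
lemma tauber {ι : Type*} {l : Filter ι} (G : ι → ℝ → ℝ) (H : ℝ → ℝ) (C : ℝ)
    (hmono : ∀ᶠ i in l, Monotone (G i)) (hbd : ∀ᶠ i in l, ∀ x, ‖G i x‖ ≤ 1)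
    (hH : ContinuousOn H (Ioi 0)) (hHb : ∀ x, 0 < x → ‖H x‖ ≤ C * exp (3 / 2 * x))
    (hlap : ∀ n : ℕ, Tendsto (fun i => ∫ x in Ioi (0:ℝ), exp (-(((n:ℝ) + 2) * x)) * G i x) l
      (𝓝 (∫ x in Ioi (0:ℝ), exp (-(((n:ℝ) + 2) * x)) * H x))) (x : ℝ) (hx : 0 < x) :
    Tendsto (fun i => G i x) l (𝓝 (H x)) := by
  have hHm : AEStronglyMeasurable H (volume.restrict (Ioi 0)) :=
    hH.aestronglyMeasurable measurableSet_Ioi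
  rw [Metric.tendsto_nhds]
  intro ε hε
  set D := |C| + 1 + |H x| + ε with hD
  have hone : ∀ y, 0 < y → 1 ≤ exp (3 / 2 * y) := fun y hy => one_le_exp (by positivity)
  have hconst : ∀ c, |c| ≤ D → ∀ y, 0 < y → ‖(fun _ : ℝ => c) y‖ ≤ D * exp (3 / 2 * y) := by
    intro c hc y hy
    have h0 : 0 ≤ D := (abs_nonneg _).trans hc
    calc ‖c‖ ≤ D * 1 := by simpa using hc
      _ ≤ _ := by gcongr; exact hone y hy
  have hHb' : ∀ x, 0 < x → ‖H x‖ ≤ D * exp (3 / 2 * x) := by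
    intro y hy
    refine (hHb y hy).trans ?_
    gcongr
    have := le_abs_self C
    have := abs_nonneg (H x)
    linarith
  have hbd' : ∀ᶠ i in l, ∀ x, 0 < x → ‖G i x‖ ≤ D * exp (3 / 2 * x) := by
    filter_upwards [hbd] with i hi y hy
    have h1 : |G i y| ≤ D := (hi y).trans (by
      have := abs_nonneg C
      have := abs_nonneg (H x)
      linarith)
    exact hconst _ h1 y hy
  have hT := tauber_cont G H D hmono hbd' hH hHb' hlap
  have hcx : ContinuousAt H x := hH.continuousAt (Ioi_mem_nhds hx)
  obtain ⟨δ, hδ, hδH⟩ := Metric.continuousAt_iff.1 hcx (ε / 2) (by positivity)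
  have hcabs : ∀ r, |r| ≤ ε → |H x + r| ≤ D := by
    intro r hr
    have := abs_add_le (H x) r
    have := abs_nonneg C
    linarith
  have hmc : ∀ c : ℝ, AEStronglyMeasurable (fun _ : ℝ => c) (volume.restrict (Ioi (0:ℝ))) :=
    fun c => aestronglyMeasurable_const
  have hpull : ∀ a b c : ℝ, ∫ y in Ioi (0:ℝ), exp (-(2 * y)) * tbump a b (exp (-y)) * c =
      (∫ y in Ioi (0:ℝ), exp (-(2 * y)) * tbump a b (exp (-y)) * 1) * c := by
    intro a b c
    rw [← integral_mul_const]; simp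

  have hup : ∀ᶠ i in l, G i x < H x + ε := by
    have I := tbump_int_pos x (x + δ) hx (by linarith)
    have t := hT (tbump x (x + δ)) (tbump_cont _ _)
    have b1 := tbump_mono x (x + δ) D hx H (fun _ => H x + ε / 2) hHm hHb' (hmc _)
      (hconst _ (hcabs _ (by rw [abs_of_pos] <;> linarith))) (by
        intro y h1 h2
        have := hδH (x := y) (by rw [Real.dist_eq, abs_lt]; constructor <;> linarith)
        rw [Real.dist_eq, abs_lt] at this
        linarith [this.2])
    rw [hpull] at b1
    have b2 : (∫ y in Ioi (0:ℝ), exp (-(2 * y)) * tbump x (x + δ) (exp (-y)) * 1) * (H x + ε / 2)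
      < (∫ y in Ioi (0:ℝ), exp (-(2 * y)) * tbump x (x + δ) (exp (-y)) * 1) * (H x + ε) := by
      gcongr; linarith
    filter_upwards [t.eventually_lt_const (b1.trans_lt b2), hmono, hbd, hbd'] with i h1 h2 h3 h4
    have b3 := tbump_mono x (x + δ) D hx (fun _ => G i x) (G i) (hmc _)
      (hconst _ ((h3 x).trans (by
        have := abs_nonneg C
        have := abs_nonneg (H x)
        linarith))) h2.measurable.aestronglyMeasurable h4 (fun y h1 _ => h2 h1.le)
    rw [hpull] at b3
    exact lt_of_mul_lt_mul_left (b3.trans_lt h1) I.le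
  have hlo : ∀ᶠ i in l, H x - ε < G i x := by
    set a := max (x / 2) (x - δ) with ha
    have ha0 : 0 < a := lt_max_of_lt_left (by positivity)
    have hax : a < x := max_lt (by linarith) (by linarith)
    have I := tbump_int_pos a x ha0 hax
    have t := hT (tbump a x) (tbump_cont _ _)
    have b1 := tbump_mono a x D ha0 (fun _ => H x + (-(ε / 2))) H (hmc _)
      (hconst _ (hcabs _ (by rw [abs_neg, abs_of_pos] <;> linarith))) hHm hHb' (by
        intro y h1 h2
        have h3 : x - δ < y := (le_max_right _ _).trans_lt h1
        have := hδH (x := y) (by rw [Real.dist_eq, abs_lt]; constructor <;> linarith)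
        rw [Real.dist_eq, abs_lt] at this
        linarith [this.1])
    rw [hpull] at b1
    have b2 : (∫ y in Ioi (0:ℝ), exp (-(2 * y)) * tbump a x (exp (-y)) * 1) * (H x - ε)
      < (∫ y in Ioi (0:ℝ), exp (-(2 * y)) * tbump a x (exp (-y)) * 1) * (H x + (-(ε / 2))) := by
      gcongr; linarith
    filter_upwards [t.eventually_const_lt (b2.trans_le b1), hmono, hbd, hbd'] with i h1 h2 h3 h4
    have b3 := tbump_mono a x D ha0 (G i) (fun _ => G i x) h2.measurable.aestronglyMeasurable h4 (hmc _)
      (hconst _ ((h3 x).trans (by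
        have := abs_nonneg C
        have := abs_nonneg (H x)
        linarith))) (fun y _ h1 => h2 h1.le)
    rw [hpull] at b3
    exact lt_of_mul_lt_mul_left (h1.trans_le b3) I.le
  filter_upwards [hup, hlo] with i h1 h2
  rw [Real.dist_eq, abs_lt]
  constructor <;> linarith

lemma lap_lintegral (μ : Measure ℝ) [SFinite μ] (w : ℝ → ENNReal) (hw : Measurable w) (s : ℝ) (hs : 0 < s) :
    ∫⁻ x in Ioi (0:ℝ), ENNReal.ofReal (exp (-(s * x))) * ∫⁻ y in Ioc 0 x, w y ∂μ =
      ∫⁻ y in Ioi 0, ENNReal.ofReal (s⁻¹ * exp (-(s * y))) * w y ∂μ := by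
  let f : ℝ → ℝ → ENNReal := fun x y =>
    {p : ℝ × ℝ | p.2 ≤ p.1}.indicator (fun p => ENNReal.ofReal (exp (-(s * p.1))) * w p.2) (x, y)
  have hfm : Measurable (Function.uncurry f) := by
    have : Function.uncurry f = {p : ℝ × ℝ | p.2 ≤ p.1}.indicator
        (fun p => ENNReal.ofReal (exp (-(s * p.1))) * w p.2) := by
      ext ⟨x, y⟩; rfl
    rw [this]
    refine Measurable.indicator ?_ (measurableSet_le measurable_snd measurable_fst)
    fun_prop
  have h1 : ∀ x, ENNReal.ofReal (exp (-(s * x))) * ∫⁻ y in Ioc 0 x, w y ∂μ =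
      ∫⁻ y in Ioi 0, f x y ∂μ := by
    intro x
    rw [← lintegral_const_mul _ hw]
    have : ∀ y, f x y = (Iic x).indicator (fun y => ENNReal.ofReal (exp (-(s * x))) * w y) y := by
      intro y
      simp only [f, indicator, mem_ofPred_eq, mem_Iic]
    simp_rw [this]
    rw [lintegral_indicator measurableSet_Iic, Measure.restrict_restrict measurableSet_Iic,
      inter_comm, Ioi_inter_Iic]
  simp_rw [h1]
  rw [lintegral_lintegral_swap hfm.aemeasurable]
  refine setLIntegral_congr_fun measurableSet_Ioi fun y hy => ?_
  have hy : 0 < y := hy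
  have : ∀ x, f x y = (Ici y).indicator (fun x => ENNReal.ofReal (exp (-(s * x))) * w y) x := by
    intro x
    simp only [f, indicator, mem_ofPred_eq, mem_Ici]
  simp_rw [this]
  rw [lintegral_indicator measurableSet_Ici, Measure.restrict_restrict measurableSet_Ici,
    inter_eq_left.2 (Ici_subset_Ioi.2 hy), lintegral_mul_const _ (by fun_prop),
    ← Measure.restrict_congr_set (Ioi_ae_eq_Ici (μ := volume) (a := y))]
  congr 1
  have hi := integrableOn_exp_mul_Ioi (a := -s) (by linarith) y
  have hv := integral_exp_mul_Ioi (a := -s) (by linarith) y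
  simp only [neg_mul] at hi hv
  rw [← ofReal_integral_eq_lintegral_ofReal hi (Eventually.of_forall fun x => (exp_pos _).le), hv]
  congr 1
  rw [neg_div_neg_eq]; field_simp

lemma cum_mono (μ : Measure ℝ) (w : ℝ → ℝ) (hw0 : ∀ y, 0 < y → 0 ≤ w y)
    (hwi : ∀ x, IntegrableOn w (Ioc 0 x) μ) : Monotone (fun x => ∫ y in Ioc 0 x, w y ∂μ) := by
  intro a b hab
  refine setIntegral_mono_set (hwi b) ?_ (Ioc_subset_Ioc_right hab).eventuallyLE
  filter_upwards [ae_restrict_mem measurableSet_Ioc] with y hy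
  exact hw0 y hy.1

lemma cum_nonneg (μ : Measure ℝ) (w : ℝ → ℝ) (hw0 : ∀ y, 0 < y → 0 ≤ w y) (x : ℝ) :
    0 ≤ ∫ y in Ioc 0 x, w y ∂μ :=
  setIntegral_nonneg measurableSet_Ioc fun y hy => hw0 y hy.1

lemma lap_real (μ : Measure ℝ) [SFinite μ] (w : ℝ → ℝ) (hw : Measurable w)
    (hw0 : ∀ y, 0 < y → 0 ≤ w y)
    (hwi : ∀ x, IntegrableOn w (Ioc 0 x) μ) (s : ℝ) (hs : 0 < s) :
    ∫ x in Ioi (0:ℝ), exp (-(s * x)) * ∫ y in Ioc 0 x, w y ∂μ =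
      s⁻¹ * ∫ y in Ioi 0, w y * exp (-(s * y)) ∂μ := by
  have hm := cum_mono μ w hw0 hwi
  rw [← integral_const_mul]
  rw [integral_eq_lintegral_of_nonneg_ae, integral_eq_lintegral_of_nonneg_ae]
  · congr 1
    have := lap_lintegral μ (fun y => ENNReal.ofReal (w y)) hw.ennreal_ofReal s hs
    rw [setLIntegral_congr_fun measurableSet_Ioi (g := fun x => ENNReal.ofReal (exp (-(s * x))) * ∫⁻ y in Ioc 0 x, ENNReal.ofReal (w y) ∂μ), this]
    · refine setLIntegral_congr_fun measurableSet_Ioi fun y hy => ?_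
      rw [← ENNReal.ofReal_mul (by positivity)]
      congr 1; ring
    · intro x hx
      simp only
      rw [ENNReal.ofReal_mul (exp_pos _).le, ofReal_integral_eq_lintegral_ofReal (hwi x)]
      filter_upwards [ae_restrict_mem measurableSet_Ioc] with y hy
      exact hw0 y hy.1
  · filter_upwards [ae_restrict_mem measurableSet_Ioi] with y hy
    have := hw0 y hy
    simp only [Pi.zero_apply]
    positivity
  · exact Measurable.aestronglyMeasurable (by fun_prop)
  · refine Eventually.of_forall fun x => ?_
    have := cum_nonneg μ w hw0 x
    simp only [Pi.zero_apply]
    positivity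
  · exact (Measurable.mul (by fun_prop) hm.measurable).aestronglyMeasurable

lemma rv_bound (M : ℝ → ℝ) (hM : Monotone M) (Y : ℝ) (hY : 0 < Y) (hpos : ∀ y, Y ≤ y → 0 < M y)
    (h2 : ∀ y, Y ≤ y → M (2 * y) ≤ 4 * M y) (y : ℝ) (hy : Y ≤ y) (u : ℝ) :
    M (u * y) / M y ≤ 1 + 4 * u ^ 2 := by
  have hy0 : 0 < y := hY.trans_le hy
  have hMy := hpos y hy
  have hn : ∀ n : ℕ, M (2 ^ n * y) ≤ 4 ^ n * M y := by
    intro n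
    induction n with
    | zero => simp
    | succ n ih =>
      have h1 : Y ≤ 2 ^ n * y := by
        have : (1:ℝ) ≤ 2 ^ n := one_le_pow₀ (by norm_num)
        nlinarith
      have := h2 _ h1
      rw [← mul_assoc, ← pow_succ'] at this
      calc _ ≤ _ := this
        _ ≤ 4 * (4 ^ n * M y) := by gcongr
        _ = _ := by ring
  rw [div_le_iff₀ hMy]
  rcases le_or_gt u 1 with hu | hu
  · have : M (u * y) ≤ M y := hM (by nlinarith)
    nlinarith [mul_nonneg (sq_nonneg u) hMy.le]
  · obtain ⟨n, h3, h4⟩ := exists_nat_pow_near hu.le (one_lt_two (α := ℝ))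
    have : M (u * y) ≤ M (2 ^ (n + 1) * y) := hM (by gcongr)
    calc _ ≤ _ := this
      _ ≤ _ := hn _
      _ = 4 * (2 ^ n) ^ 2 * M y := by
        rw [show (4:ℝ) = 2 ^ 2 by norm_num, ← pow_mul, ← pow_mul, ← pow_add]; congr 2; ring
      _ ≤ (4 * u ^ 2) * M y := by gcongr
      _ ≤ _ := by nlinarith

lemma abel (M : ℝ → ℝ) (hM : Monotone M) (hM0 : ∀ x, 0 ≤ M x) (α : ℝ) (hα0 : 0 ≤ α) (hα : α ≤ 1)
    (hpos : ∀ᶠ y in atTop, 0 < M y)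
    (hrv : ∀ c, 0 < c → Tendsto (fun y => M (c * y) / M y) atTop (𝓝 (c ^ α))) :
    Tendsto (fun y => ∫ u in Ioi (0:ℝ), exp (-u) * (M (u * y) / M y)) atTop
      (𝓝 (Real.Gamma (α + 1))) := by
  have hlt : (2:ℝ) ^ α < 4 := by
    calc (2:ℝ) ^ α ≤ 2 ^ (1:ℝ) := Real.rpow_le_rpow_of_exponent_le (by norm_num) hα
      _ < 4 := by norm_num
  have hev : ∀ᶠ y in atTop, 0 < M y ∧ M (2 * y) ≤ 4 * M y := by
    filter_upwards [hpos, (hrv 2 (by norm_num)).eventually_lt_const hlt] with y h1 h2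
    refine ⟨h1, ?_⟩
    rw [div_lt_iff₀ h1] at h2
    exact h2.le
  obtain ⟨Y0, hY0⟩ := eventually_atTop.1 hev
  set Y := max Y0 1
  have hYp : 0 < Y := lt_max_of_lt_right one_pos
  have hb := rv_bound M hM Y hYp (fun y hy => (hY0 y ((le_max_left _ _).trans hy)).1)
    (fun y hy => (hY0 y ((le_max_left _ _).trans hy)).2)
  rw [Real.Gamma_eq_integral (by linarith)]
  refine tendsto_integral_filter_of_dominated_convergence (fun u => exp (-u) * (1 + 4 * u ^ 2)) ?_ ?_ ?_ ?_
  · filter_upwards [eventually_gt_atTop 0] with y hy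
    refine (Measurable.mul (by fun_prop) ?_).aestronglyMeasurable
    refine Measurable.div_const ?_ _
    exact hM.measurable.comp (by fun_prop)
  · filter_upwards [eventually_ge_atTop Y] with y hy
    refine Eventually.of_forall fun u => ?_
    have h1 := hb y hy u
    have h2 : 0 ≤ M (u * y) / M y := div_nonneg (hM0 _) (hM0 _)
    rw [norm_mul, Real.norm_of_nonneg (exp_pos _).le, Real.norm_of_nonneg h2]
    gcongr
  · have i1 := Real.GammaIntegral_convergent (s := 1) (by norm_num)
    have i2 := Real.GammaIntegral_convergent (s := 3) (by norm_num)
    refine (i1.add (i2.const_mul 4)).congr (Eventually.of_forall fun u => ?_)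
    have : u ^ ((3:ℝ) - 1) = u ^ 2 := by
      rw [show ((3:ℝ) - 1) = (2:ℕ) by norm_num, Real.rpow_natCast]
    simp only [Pi.add_apply, this]
    simp
    ring
  · filter_upwards [ae_restrict_mem measurableSet_Ioi] with u hu
    rw [add_sub_cancel_right]
    exact (hrv u hu).const_mul _

lemma laplace_rv (M ψ : ℝ → ℝ) (hM : Monotone M) (hM0 : ∀ x, 0 ≤ M x) (α : ℝ) (hα0 : 0 ≤ α) (hα : α ≤ 1)
    (hpos : ∀ᶠ y in atTop, 0 < M y)
    (hrv : ∀ c, 0 < c → Tendsto (fun y => M (c * y) / M y) atTop (𝓝 (c ^ α)))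
    (hψ : ∀ s, 0 < s → ψ s = s * ∫ x in Ioi (0:ℝ), exp (-(s * x)) * M x) (c : ℝ) (hc : 0 < c) :
    Tendsto (fun s => ψ (c * s) / ψ s) (𝓝[>] 0) (𝓝 ((c⁻¹) ^ α)) := by
  have hA := abel M hM hM0 α hα0 hα hpos hrv
  have hψ' : ∀ s, 0 < s → ψ s = ∫ u in Ioi (0:ℝ), exp (-u) * M (u * s⁻¹) := by
    intro s hs
    have := integral_comp_mul_left_Ioi (fun u => exp (-u) * M (u * s⁻¹)) 0 hs
    rw [mul_zero, smul_eq_mul] at this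
    rw [hψ s hs]
    have e : ∀ x, exp (-(s * x)) * M x = exp (-(s * x)) * M (s * x * s⁻¹) := by
      intro x; congr 2; field_simp
    simp_rw [e]
    rw [this]; field_simp
  set A := fun y => ∫ u in Ioi (0:ℝ), exp (-u) * (M (u * y) / M y) with hAdef
  have hψA : ∀ s, 0 < s → 0 < M s⁻¹ → ψ s = M s⁻¹ * A s⁻¹ := by
    intro s hs hms
    rw [hψ' s hs, hAdef]
    simp only
    rw [← integral_const_mul]
    congr 1; ext u
    rw [mul_left_comm, mul_div_cancel₀ _ hms.ne']
  have hG : 0 < Real.Gamma (α + 1) := Real.Gamma_pos_of_pos (by linarith)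
  have t0 : Tendsto (fun s : ℝ => s⁻¹) (𝓝[>] 0) atTop := tendsto_inv_nhdsGT_zero
  have t1 : Tendsto (fun y : ℝ => c⁻¹ * y) atTop atTop := tendsto_id.const_mul_atTop (by positivity)
  have key : Tendsto (fun y => M (c⁻¹ * y) / M y * (A (c⁻¹ * y) / A y)) atTop (𝓝 ((c⁻¹) ^ α)) := by
    have := (hrv c⁻¹ (by positivity)).mul ((hA.comp t1).div hA hG.ne')
    rw [div_self hG.ne', mul_one] at this
    exact this
  refine (key.comp t0).congr' ?_
  filter_upwards [self_mem_nhdsWithin, t0.eventually hpos, t0.eventually (t1.eventually hpos)] with s hs h1 h2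
  have hs : 0 < s := hs
  have e : (c * s)⁻¹ = c⁻¹ * s⁻¹ := by rw [mul_inv]
  rw [hψA s hs h1, hψA (c * s) (by positivity) (by rw [e]; exact h2), e]
  simp only [Function.comp]
  rw [mul_div_mul_comm]

/-- Facts about the Laplace exponent. -/
lemma phi_facts (ν₀ : Measure ℝ) [IsFiniteMeasure ν₀] (hν₀supp : ν₀ (Set.Iic 0) = 0) (hne : ν₀ ≠ 0)
    (φ₀ : ℝ → ℝ) (hφ₀ : ∀ s : ℝ, φ₀ s = ∫ x, (1 - Real.exp (-(s * x))) ∂ν₀) :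
    (∀ s, 0 < s → HasDerivAt φ₀ (∫ x, x * exp (-(s * x)) ∂ν₀) s) ∧
    (∀ s, 0 < s → 0 < ∫ x, x * exp (-(s * x)) ∂ν₀) ∧
    (∀ s, 0 < s → 0 < φ₀ s) ∧ StrictMonoOn φ₀ (Ioi 0) ∧
    Tendsto φ₀ (𝓝[>] 0) (𝓝 0) ∧ Tendsto φ₀ atTop (𝓝 (ν₀.real univ)) := by
  have hae : ∀ᵐ x ∂ν₀, 0 < x := by
    rw [ae_iff]
    convert hν₀supp using 2
    ext x; simp
  have hexp : ∀ s, 0 < s → ∀ᵐ x ∂ν₀, ‖exp (-(s * x))‖ ≤ 1 := by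
    intro s hs
    filter_upwards [hae] with x hx
    rw [Real.norm_of_nonneg (exp_pos _).le, exp_le_one_iff]
    have := mul_pos hs hx
    linarith
  have hei : ∀ s, 0 < s → Integrable (fun x => exp (-(s * x))) ν₀ := by
    intro s hs
    refine Integrable.mono' (integrable_const 1) (by fun_prop) (hexp s hs)
  have hD : ∀ s, 0 < s → Integrable (fun x => x * exp (-(s * x))) ν₀ ∧ HasDerivAt φ₀ (∫ x, x * exp (-(s * x)) ∂ν₀) s := by
    intro s hs
    have hF : φ₀ = fun s => ∫ x, (1 - Real.exp (-(s * x))) ∂ν₀ := funext hφ₀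
    rw [hF]
    refine hasDerivAt_integral_of_dominated_loc_of_deriv_le (s := Ioi (s/2)) (bound := fun _ => 2 / s)
      (F := fun s x => 1 - Real.exp (-(s * x))) (F' := fun s x => x * exp (-(s * x)))
      (Ioi_mem_nhds (by linarith)) ?_ ?_ ?_ ?_ (integrable_const _) ?_
    · exact Eventually.of_forall fun x => by fun_prop
    · exact (integrable_const _).sub (hei s hs)
    · fun_prop
    · filter_upwards [hae] with x hx r hr
      have hr : s / 2 < r := hr
      have h1 : x * exp (-(s / 2 * x)) ≤ 2 / s := by
        have h2 : s / 2 * x ≤ exp (s / 2 * x) := by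
          have := add_one_le_exp (s / 2 * x); linarith
        rw [exp_neg, ← div_eq_mul_inv, div_le_iff₀ (exp_pos _)]
        calc x = 2 / s * (s / 2 * x) := by field_simp
          _ ≤ _ := by gcongr
      rw [Real.norm_of_nonneg (by positivity)]
      refine le_trans ?_ h1
      gcongr
    · filter_upwards with x r hr
      have h1 : HasDerivAt (fun r => -(r * x)) (-x) r := by
        simpa using! ((hasDerivAt_id r).mul_const x).neg
      have := (h1.exp).const_sub 1
      convert! this using 1
      ring
  have hpos : ∀ s, 0 < s → 0 < ∫ x, x * exp (-(s * x)) ∂ν₀ := by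
    intro s hs
    rw [integral_pos_iff_support_of_nonneg_ae _ (hD s hs).1]
    · have : ν₀ (Function.support (fun x => x * exp (-(s * x)))) = ν₀ univ := by
        apply measure_congr
        filter_upwards [hae] with x hx
        apply propext
        have : x * exp (-(s * x)) ≠ 0 := by positivity
        exact ⟨fun _ => trivial, fun _ => this⟩
      rw [this]
      exact Measure.measure_univ_pos.2 hne
    · filter_upwards [hae] with x hx
      simp only [Pi.zero_apply]
      positivity
  have hmono : StrictMonoOn φ₀ (Ioi 0) := by
    refine strictMonoOn_of_deriv_pos (convex_Ioi 0) ?_ ?_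
    · exact fun s hs => ((hD s hs).2.continuousAt).continuousWithinAt
    · intro s hs
      rw [interior_Ioi] at hs
      rw [(hD s hs).2.deriv]
      exact hpos s hs
  have hb : ∀ s, 0 < s → ∀ᵐ x ∂ν₀, ‖1 - exp (-(s * x))‖ ≤ 1 := by
    intro s hs
    filter_upwards [hae, hexp s hs] with x hx h
    rw [Real.norm_of_nonneg (exp_pos _).le] at h
    rw [Real.norm_of_nonneg (by linarith)]
    linarith [exp_pos (-(s * x))]
  have hF : φ₀ = fun s => ∫ x, (1 - Real.exp (-(s * x))) ∂ν₀ := funext hφ₀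
  have hnn : ∀ s, 0 < s → 0 ≤ φ₀ s := by
    intro s hs
    rw [hφ₀]
    refine integral_nonneg_of_ae ?_
    filter_upwards [hexp s hs] with x h
    rw [Real.norm_of_nonneg (exp_pos _).le] at h
    simp only [Pi.zero_apply]
    linarith
  refine ⟨fun s hs => (hD s hs).2, hpos, ?_, hmono, ?_, ?_⟩
  · intro s hs
    have h1 := hnn (s / 2) (by positivity)
    have h2 := hmono (a := s / 2) (b := s) (by simpa using hs) hs (by linarith)
    linarith
  · rw [hF]
    have : (0:ℝ) = ∫ x, (0:ℝ) ∂ν₀ := by simp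
    conv => rhs; rw [this]
    refine tendsto_integral_filter_of_dominated_convergence (fun _ => 1) ?_ ?_ (integrable_const _) ?_
    · exact Eventually.of_forall fun s => by fun_prop
    · filter_upwards [self_mem_nhdsWithin] with s hs using hb s hs
    · refine Eventually.of_forall fun x => ?_
      have : Continuous (fun s => 1 - exp (-(s * x))) := by fun_prop
      have := this.tendsto 0
      simp only [zero_mul, neg_zero, exp_zero, sub_self] at this
      exact this.mono_left nhdsWithin_le_nhds
  · rw [hF]
    have : ν₀.real univ = ∫ x, (1:ℝ) ∂ν₀ := by simp
    rw [this]
    refine tendsto_integral_filter_of_dominated_convergence (fun _ => 1) ?_ ?_ (integrable_const _) ?_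
    · exact Eventually.of_forall fun s => by fun_prop
    · filter_upwards [eventually_gt_atTop 0] with s hs using hb s hs
    · filter_upwards [hae] with x hx
      have h1 : Tendsto (fun s => s * x) atTop atTop := tendsto_id.atTop_mul_const hx
      have h2 := (tendsto_exp_neg_atTop_nhds_zero.comp h1).const_sub 1
      simpa using h2

lemma phi_rv (φ ψ : ℝ → ℝ) (ρ : ℝ) (hd : ∀ s, 0 < s → HasDerivAt φ (ψ s) s) (hψ : ∀ s, 0 < s → 0 < ψ s)
    (h0 : Tendsto φ (𝓝[>] 0) (𝓝 0)) (c : ℝ) (hc : 0 < c)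
    (hrv : Tendsto (fun s => ψ (c * s) / ψ s) (𝓝[>] 0) (𝓝 ((c⁻¹) ^ (1 - ρ)))) :
    Tendsto (fun s => φ (c * s) / φ s) (𝓝[>] 0) (𝓝 (c ^ ρ)) := by
  have e : c ^ ρ = c * (c⁻¹) ^ (1 - ρ) := by
    have h1 := Real.rpow_add hc 1 (-(1 - ρ))
    rw [Real.rpow_one] at h1
    rw [Real.inv_rpow hc.le, ← Real.rpow_neg hc.le, ← h1]
    congr 1; ring
  have hmem : ∀ᶠ s : ℝ in 𝓝[>] 0, 0 < s := self_mem_nhdsWithin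
  have hct : Tendsto (fun s : ℝ => c * s) (𝓝[>] 0) (𝓝[>] 0) := by
    refine tendsto_nhdsWithin_iff.2 ⟨?_, ?_⟩
    · have : Continuous (fun s : ℝ => c * s) := by fun_prop
      have := this.tendsto 0
      rw [mul_zero] at this
      exact this.mono_left nhdsWithin_le_nhds
    · filter_upwards [hmem] with s hs using mul_pos hc hs
  refine HasDerivAt.lhopital_zero_nhdsGT (f' := fun s => c * ψ (c * s)) (g' := ψ) ?_ ?_ ?_ (h0.comp hct) h0 ?_
  · filter_upwards [hmem] with s hs
    have h1 := hd (c * s) (by positivity)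
    have h2 : HasDerivAt (fun s => c * s) c s := by simpa using (hasDerivAt_id s).const_mul c
    have := h1.comp s h2
    rw [mul_comm] at this
    exact this
  · filter_upwards [hmem] with s hs using hd s hs
  · filter_upwards [hmem] with s hs using (hψ s hs).ne'
  · rw [e]
    simp_rw [mul_div_assoc]
    exact hrv.const_mul c

lemma exists_lam (φ : ℝ → ℝ) (m : ℝ) (hm : 0 < m) (hmono : StrictMonoOn φ (Ioi 0))
    (hcont : ∀ s, 0 < s → ContinuousAt φ s) (hpos : ∀ s, 0 < s → 0 < φ s)
    (h0 : Tendsto φ (𝓝[>] 0) (𝓝 0)) (hinf : Tendsto φ atTop (𝓝 m)) :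
    ∃ lam : ℝ → ℝ, StrictMonoOn lam (Ioi 0) ∧ Tendsto lam atTop atTop ∧
      (∀ t, 0 < t → 0 < lam t) ∧ ∀ᶠ t in atTop, φ (lam t)⁻¹ = t⁻¹ := by
  set t0 := 2 / m with ht0
  have ht0p : 0 < t0 := by positivity
  have hex : ∀ t : ℝ, ∃ s, 0 < s ∧ (t0 ≤ t → φ s = t⁻¹) := by
    intro t
    by_cases ht : t0 ≤ t
    · have htp : 0 < t := ht0p.trans_le ht
      have h1 : t⁻¹ < m := by
        calc t⁻¹ ≤ t0⁻¹ := by gcongr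
          _ = m / 2 := by rw [ht0, inv_div]
          _ < m := by linarith
      have e1 := h0.eventually_lt_const (inv_pos.2 htp)
      obtain ⟨s1, hs1, hs1p⟩ := (e1.and self_mem_nhdsWithin).exists
      obtain ⟨s2, hs2, hs2p⟩ := ((hinf.eventually_const_lt h1).and (eventually_gt_atTop s1)).exists
      have hs1p : 0 < s1 := hs1p
      obtain ⟨s, hs, hse⟩ := intermediate_value_Icc hs2p.le
        (fun s hs => (hcont s (hs1p.trans_le hs.1)).continuousWithinAt) ⟨hs1.le, hs2.le⟩
      exact ⟨s, hs1p.trans_le hs.1, fun _ => hse⟩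
    · exact ⟨1, one_pos, fun h => absurd h ht⟩
  choose σ hσp hσ using hex
  have hanti : ∀ a b, t0 ≤ a → a < b → (σ a)⁻¹ < (σ b)⁻¹ := by
    intro a b ha hab
    have hap : 0 < a := ht0p.trans_le ha
    have h1 : φ (σ b) < φ (σ a) := by
      rw [hσ a ha, hσ b (ha.trans hab.le)]
      gcongr
    have h2 : σ b < σ a := (hmono.lt_iff_lt (hσp b) (hσp a)).1 h1
    exact inv_strictAnti₀ (hσp b) h2
  refine ⟨fun t => if t0 ≤ t then (σ t)⁻¹ else (σ t0)⁻¹ * (t / t0), ?_, ?_, ?_, ?_⟩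
  · intro a ha b hb hab
    have ha : 0 < a := ha
    have hσ0 : 0 < (σ t0)⁻¹ := inv_pos.2 (hσp t0)
    by_cases h1 : t0 ≤ a
    · have h2 : t0 ≤ b := h1.trans hab.le
      simp only [h1, h2, if_true]
      exact hanti a b h1 hab
    · by_cases h2 : t0 ≤ b
      · simp only [h1, h2, if_true, if_false]
        have h3 : (σ t0)⁻¹ ≤ (σ b)⁻¹ := by
          rcases h2.eq_or_lt with h | h
          · rw [← h]
          · exact (hanti _ _ le_rfl h).le
        have h4 : a / t0 < 1 := by rw [div_lt_one ht0p]; linarith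
        nlinarith
      · simp only [h1, h2, if_false]
        gcongr
  · rw [tendsto_atTop]
    intro b
    set b' := max b 1
    have hb' : 0 < b' := lt_max_of_lt_right one_pos
    have hp := hpos b'⁻¹ (inv_pos.2 hb')
    filter_upwards [tendsto_inv_atTop_zero.eventually_lt_const hp, eventually_ge_atTop t0] with t h1 h2
    simp only [h2, if_true]
    rw [← hσ t h2] at h1
    have h3 : σ t < b'⁻¹ := (hmono.lt_iff_lt (hσp t) (inv_pos.2 hb')).1 h1
    have h4 : b' < (σ t)⁻¹ := (lt_inv_comm₀ (hσp t) hb').1 h3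
    exact (le_max_left b 1).trans h4.le
  · intro t ht
    have h1 := hσp t
    have h2 := hσp t0
    simp only
    split_ifs <;> positivity
  · filter_upwards [eventually_ge_atTop t0] with t ht
    simp only [ht, if_true, inv_inv]
    exact hσ t ht

lemma total_mass (μ : Measure ℝ) (hsupp : μ (Iic 0) = 0) (φ : ℝ → ℝ) (hpos : ∀ s, 0 < s → 0 < φ s)
    (m : ℝ) (hm : 0 < m) (hinf : Tendsto φ atTop (𝓝 m)) (t : ℝ) (ht : 0 < t)
    (hμ : ∀ s : ℝ, 0 < s → ∫ x, (1 - Real.exp (-(s * x))) ∂μ = φ s / (1 + t * φ s)) :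
    μ univ = ENNReal.ofReal (m / (1 + t * m)) := by
  have hae : ∀ᵐ x ∂μ, 0 < x := by
    rw [ae_iff]
    convert hsupp using 2
    ext x; simp
  have hInteg : ∀ s, 0 < s → Integrable (fun x => 1 - Real.exp (-(s * x))) μ := by
    intro s hs
    by_contra h
    have h1 := hμ s hs
    rw [integral_undef h] at h1
    have := hpos s hs
    have : 0 < φ s / (1 + t * φ s) := by positivity
    linarith
  have hl : ∀ n : ℕ, ∫⁻ x, ENNReal.ofReal (1 - exp (-(((n:ℝ) + 1) * x))) ∂μ =
      ENNReal.ofReal (φ ((n:ℝ) + 1) / (1 + t * φ ((n:ℝ) + 1))) := by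
    intro n
    rw [← hμ _ (by positivity), ofReal_integral_eq_lintegral_ofReal (hInteg _ (by positivity))]
    filter_upwards [hae] with x hx
    have : exp (-(((n:ℝ) + 1) * x)) ≤ 1 := by
      rw [exp_le_one_iff]
      have : 0 < ((n:ℝ) + 1) * x := by positivity
      linarith
    simp only [Pi.zero_apply]
    linarith
  have hn : Tendsto (fun n : ℕ => (n:ℝ) + 1) atTop atTop :=
    tendsto_atTop_add_const_right _ _ tendsto_natCast_atTop_atTop
  have h1 : Tendsto (fun n : ℕ => ∫⁻ x, ENNReal.ofReal (1 - exp (-(((n:ℝ) + 1) * x))) ∂μ) atTop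
      (𝓝 (∫⁻ x, 1 ∂μ)) := by
    refine lintegral_tendsto_of_tendsto_of_monotone ?_ ?_ ?_
    · intro n; fun_prop
    · filter_upwards [hae] with x hx a b hab
      apply ENNReal.ofReal_le_ofReal
      gcongr
    · filter_upwards [hae] with x hx
      have h1 : Tendsto (fun n : ℕ => ((n:ℝ) + 1) * x) atTop atTop := hn.atTop_mul_const hx
      have h2 := (tendsto_exp_neg_atTop_nhds_zero.comp h1).const_sub 1
      rw [sub_zero] at h2
      have := ENNReal.tendsto_ofReal h2
      rw [ENNReal.ofReal_one] at this
      exact this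
  simp_rw [hl] at h1
  have h2 : Tendsto (fun n : ℕ => ENNReal.ofReal (φ ((n:ℝ) + 1) / (1 + t * φ ((n:ℝ) + 1)))) atTop
      (𝓝 (ENNReal.ofReal (m / (1 + t * m)))) := by
    refine ENNReal.tendsto_ofReal ?_
    have h3 := hinf.comp hn
    exact h3.div ((h3.const_mul t).const_add 1) (by positivity)
  have := tendsto_nhds_unique h1 h2
  rw [lintegral_one] at this
  exact this

lemma sol_laplace (μ : Measure ℝ) [IsFiniteMeasure μ] (hsupp : μ (Iic 0) = 0) (m : ℝ)
    (hm : μ.real univ = m) (l s : ℝ) (hl : 0 < l) (hs : 0 < s) :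
    ∫ x in Ioi (0:ℝ), exp (-(s * x)) * ((μ (Ioc 0 (l * x))).toReal / (μ (Ioi 0)).toReal) =
      s⁻¹ * ((m - ∫ x, (1 - exp (-(s * l⁻¹ * x))) ∂μ) / m) := by
  have hae : ∀ᵐ x ∂μ, 0 < x := by
    rw [ae_iff]
    convert hsupp using 2
    ext x; simp
  have hres : μ.restrict (Ioi 0) = μ := Measure.restrict_eq_self_of_ae_mem hae
  have hm' : (μ (Ioi 0)).toReal = m := by
    rw [← hm, measureReal_def]
    congr 1
    rw [← Measure.restrict_apply_univ, hres]
  have hei : Integrable (fun x => exp (-(s * l⁻¹ * x))) μ := by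
    refine Integrable.mono' (integrable_const 1) (by fun_prop) ?_
    filter_upwards [hae] with x hx
    rw [Real.norm_of_nonneg (exp_pos _).le, exp_le_one_iff]
    have : 0 < s * l⁻¹ * x := by positivity
    linarith
  have h := lap_real μ (fun _ => 1) measurable_const (fun _ _ => zero_le_one)
    (fun x => integrable_const _) (s * l⁻¹) (by positivity)
  simp only [one_mul, hres] at h
  have hc := integral_comp_mul_left_Ioi
    (fun y => exp (-(s * l⁻¹ * y)) * ∫ z in Ioc 0 y, (1:ℝ) ∂μ) 0 hl
  rw [mul_zero, h, smul_eq_mul] at hc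
  have e : ∀ x, exp (-(s * x)) * ((μ (Ioc 0 (l * x))).toReal / (μ (Ioi 0)).toReal) =
      exp (-(s * l⁻¹ * (l * x))) * (∫ z in Ioc 0 (l * x), (1:ℝ) ∂μ) / m := by
    intro x
    rw [hm', show s * l⁻¹ * (l * x) = s * x by field_simp, mul_div_assoc]
    simp [measureReal_def]
  simp_rw [e]
  rw [integral_div, hc, integral_sub (integrable_const _) hei]
  simp only [integral_const, smul_eq_mul, mul_one, hm, sub_sub_cancel]
  field_simp


theorem const_kernel_scaling_sufficiency
    -- ν₀ : finite positive measure on (0,∞)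
    (ν₀ : Measure ℝ) [IsFiniteMeasure ν₀] (hν₀supp : ν₀ (Set.Iic 0) = 0)
    -- desingularized Laplace transform of ν₀
    (φ₀ : ℝ → ℝ) (hφ₀ : ∀ s : ℝ, φ₀ s = ∫ x, (1 - Real.exp (-(s * x))) ∂ν₀)
    -- (ν t) is the solution with kernel K = 2 and initial data ν₀
    (ν : ℝ → Measure ℝ)
    (hsol : ∀ t : ℝ, 0 ≤ t → (ν t) (Set.Iic 0) = 0 ∧
      ∀ s : ℝ, 0 < s →
        ∫ x, (1 - Real.exp (-(s * x))) ∂(ν t) = φ₀ s / (1 + t * φ₀ s))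
    -- normalized (size-biased) distribution function F(t,x)
    (F : ℝ → ℝ → ℝ)
    (hF : ∀ t : ℝ, 0 < t → ∀ x : ℝ,
      F t x = ((ν t) (Set.Ioc 0 x)).toReal / ((ν t) (Set.Ioi 0)).toReal)
    -- hypothesis: ∫₀^x y ν₀(dy) ~ x^{1-ρ} L(x) as x → ∞ with ρ ∈ (0,1], L slowly varying
    (ρ : ℝ) (hρ : ρ ∈ Set.Ioc (0:ℝ) 1)
    (L : ℝ → ℝ)
    (hLpos : ∀ x : ℝ, 0 < x → 0 < L x)
    (hLslow : ∀ c : ℝ, 0 < c → Tendsto (fun x => L (c * x) / L x) atTop (𝓝 1))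
    (htail : Tendsto (fun x => (∫ y in Set.Ioc (0:ℝ) x, y ∂ν₀) / (x ^ (1 - ρ) * L x))
      atTop (𝓝 1)) :
    -- conclusion: strictly increasing rescaling λ(t) → ∞ with
    -- F(t, λ(t) x) → F_ρ(x) for all x ∈ (0,∞)
    ∃ lam : ℝ → ℝ, StrictMonoOn lam (Set.Ioi 0) ∧ Tendsto lam atTop atTop ∧
      ∀ x : ℝ, 0 < x →
        Tendsto (fun t => F t (lam t * x)) atTop (𝓝 (mittagLefflerCDF ρ x)) := by
  obtain ⟨hρ0, hρ1⟩ := hρ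
  set M : ℝ → ℝ := fun x => ∫ y in Set.Ioc (0:ℝ) x, y ∂ν₀ with hMdef
  have hwi : ∀ x, IntegrableOn (fun y : ℝ => y) (Ioc 0 x) ν₀ := by
    intro x
    refine Integrable.mono' (integrable_const x) (by fun_prop) ?_
    filter_upwards [ae_restrict_mem measurableSet_Ioc] with y hy
    rw [Real.norm_of_nonneg hy.1.le]
    exact hy.2
  have hMmono : Monotone M := cum_mono ν₀ (fun y => y) (fun y hy => hy.le) hwi
  have hM0 : ∀ x, 0 ≤ M x := cum_nonneg ν₀ (fun y => y) (fun y hy => hy.le)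
  have hMpos : ∀ᶠ y in atTop, 0 < M y := by
    filter_upwards [htail.eventually_const_lt one_pos] with y hy
    refine lt_of_le_of_ne (hM0 y) fun h => ?_
    have h' : ∫ y in Set.Ioc (0:ℝ) y, y ∂ν₀ = 0 := h.symm
    rw [h', zero_div] at hy
    exact lt_irrefl _ hy
  have hrv : ∀ c, 0 < c → Tendsto (fun y => M (c * y) / M y) atTop (𝓝 (c ^ (1 - ρ))) := by
    intro c hc
    have t1 : Tendsto (fun y : ℝ => c * y) atTop atTop := tendsto_id.const_mul_atTop hc
    have h1 := ((htail.comp t1).div htail one_ne_zero).mul ((hLslow c hc).mul_const (c ^ (1 - ρ)))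
    rw [div_one, one_mul, one_mul] at h1
    refine h1.congr' ?_
    filter_upwards [eventually_gt_atTop 0, hMpos] with y hy hMy
    have l1 := hLpos y hy
    have l2 := hLpos (c * y) (by positivity)
    have l3 : 0 < y ^ (1 - ρ) := by positivity
    have l4 : 0 < c ^ (1 - ρ) := by positivity
    change M (c * y) / ((c * y) ^ (1 - ρ) * L (c * y)) / (M y / (y ^ (1 - ρ) * L y)) *
      (L (c * y) / L y * c ^ (1 - ρ)) = M (c * y) / M y
    rw [Real.mul_rpow hc.le hy.le]
    field_simp
  have hne : ν₀ ≠ 0 := by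
    intro h
    obtain ⟨y, hy⟩ := hMpos.exists
    simp [hMdef, h] at hy
  obtain ⟨hd, hψpos, hφpos, hφmono, hφ0, hφinf⟩ := phi_facts ν₀ hν₀supp hne φ₀ hφ₀
  have hae : ∀ᵐ x ∂ν₀, x ∈ Ioi (0:ℝ) := by
    rw [ae_iff]
    convert hν₀supp using 2
    ext x; simp
  have hψ : ∀ s, 0 < s → (fun s => ∫ x, x * exp (-(s * x)) ∂ν₀) s =
      s * ∫ x in Ioi (0:ℝ), exp (-(s * x)) * M x := by
    intro s hs
    have := lap_real ν₀ (fun y => y) measurable_id (fun y hy => hy.le) hwi s hs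
    rw [Measure.restrict_eq_self_of_ae_mem hae] at this
    rw [hMdef, this, ← mul_assoc, mul_inv_cancel₀ hs.ne', one_mul]
  have hφrv : ∀ c, 0 < c → Tendsto (fun s => φ₀ (c * s) / φ₀ s) (𝓝[>] 0) (𝓝 (c ^ ρ)) := by
    intro c hc
    exact phi_rv φ₀ _ ρ hd hψpos hφ0 c hc
      (laplace_rv M _ hMmono hM0 (1 - ρ) (by linarith) (by linarith) hMpos hrv hψ c hc)
  have hm : 0 < ν₀.real univ := by
    rw [measureReal_def]
    exact ENNReal.toReal_pos (Measure.measure_univ_pos.2 hne).ne' (measure_ne_top _ _)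
  set m := ν₀.real univ
  obtain ⟨lam, hlmono, hltop, hlpos, hlφ⟩ := exists_lam φ₀ m hm hφmono
    (fun s hs => (hd s hs).continuousAt) hφpos hφ0 hφinf
  refine ⟨lam, hlmono, hltop, ?_⟩
  have hmass : ∀ t, 0 < t → (ν t) univ = ENNReal.ofReal (m / (1 + t * m)) := fun t ht =>
    total_mass (ν t) (hsol t ht.le).1 φ₀ hφpos m hm hφinf t ht (hsol t ht.le).2
  have hfin : ∀ t, 0 < t → IsFiniteMeasure (ν t) := fun t ht =>
    ⟨by rw [hmass t ht]; exact ENNReal.ofReal_lt_top⟩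
  intro x hx
  refine tauber (fun t x => F t (lam t * x)) (mittagLefflerCDF ρ) _ ?_ ?_ (ml_cont ρ hρ0)
    (fun x hx => ml_bound ρ x hρ0 hx) ?_ x hx
  · filter_upwards [eventually_gt_atTop 0] with t ht a b hab
    have := hfin t ht
    have hl := hlpos t ht
    simp only [hF t ht]
    gcongr
    exact measure_ne_top _ _
  · filter_upwards [eventually_gt_atTop 0] with t ht y
    have := hfin t ht
    simp only [hF t ht]
    rw [Real.norm_of_nonneg (by positivity)]
    refine div_le_one_of_le₀ ?_ ENNReal.toReal_nonneg
    exact ENNReal.toReal_mono (measure_ne_top _ _) (measure_mono Ioc_subset_Ioi_self)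
  · intro n
    set s : ℝ := (n:ℝ) + 2 with hs
    have hs0 : 0 < s := by positivity
    have hs1 : 1 < s := by
      have : (0:ℝ) ≤ n := n.cast_nonneg
      linarith
    rw [ml_laplace ρ hρ0 s hs1]
    have hli : Tendsto (fun t => (lam t)⁻¹) atTop (𝓝[>] 0) := tendsto_inv_atTop_nhdsGT_zero.comp hltop
    have h1 := (hφrv s hs0).comp hli
    have hsρ : 0 < s ^ ρ := by positivity
    have h2 : Tendsto (fun t : ℝ => 1 + t⁻¹ * m⁻¹) atTop (𝓝 1) := by
      have := (tendsto_inv_atTop_zero (𝕜 := ℝ)).mul_const m⁻¹ |>.const_add 1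
      simpa using this
    have h3 := ((((h1.div (h1.const_add 1) (by positivity)).mul h2).const_sub 1).const_mul s⁻¹)
    have e : s⁻¹ * (1 / (1 + s ^ ρ)) = s⁻¹ * (1 - s ^ ρ / (1 + s ^ ρ) * 1) := by
      field_simp; ring
    rw [e]
    refine h3.congr' ?_
    filter_upwards [eventually_gt_atTop 0, hlφ] with t ht hφt
    have := hfin t ht
    have hl := hlpos t ht
    simp only [hF t ht]
    have hreal : (ν t).real univ = m / (1 + t * m) := by
      rw [measureReal_def, hmass t ht, ENNReal.toReal_ofReal (by positivity)]
    rw [sol_laplace (ν t) (hsol t ht.le).1 _ hreal (lam t) s hl hs0,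
      (hsol t ht.le).2 _ (by positivity)]
    have hp := hφpos (s * (lam t)⁻¹) (by positivity)
    simp only [Pi.div_apply, Function.comp, hφt]
    generalize φ₀ (s * (lam t)⁻¹) = q at hp
    congr 1
    have q1 : 0 < 1 + t * q := by positivity
    have q2 : 0 < 1 + t * m := by positivity
    have q3 : 1 + q / t⁻¹ = 1 + t * q := by field_simp
    rw [q3]
    field_simp
    ring
end
end
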